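/- arXiv:1302.5289 — 6 statements merged into one kernel-verified Lean document; each statement's English description precedes it below -/
import Mathlib

section
/- Let F be a field and let A be a finite-dimensional central simple algebra over F with dim_F A = n² for a positive integer n. For every g ∈ A, let L(g) : A → A denote the F-linear map of left multiplication by g. Then there exists a monic polynomial P ∈ F[X] of degree n such that the characteristic polynomial of the F-linear endomorphism L(g) equals P^n. -/
open Polynomial

open scoped TensorProduct

/-- The characteristic polynomial is multiplicative along an invariant submodule. -/
theorem LinearMap.charpoly_eq_charpoly_restrict_mul_charpoly_mapQ
    {R V : Type*} [CommRing R] [AddCommGroup V] [Module R V] [Module.Finite R V] [Module.Free R V]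
    (W : Submodule R V) [Module.Free R W] [Module.Finite R W] [Module.Free R (V ⧸ W)]
    (e : V →ₗ[R] V) (he : W ≤ W.comap e) :
    e.charpoly = (e.restrict he).charpoly * (W.mapQ W e he).charpoly := by
  let bW := Module.Free.chooseBasis R W
  let bQ := Module.Free.chooseBasis R (V ⧸ W)
  let b := Module.Basis.sumQuot bW bQ
  suffices LinearMap.toMatrix b b e = Matrix.fromBlocks
      (LinearMap.toMatrix bW bW (e.restrict he))
      (Matrix.of fun i l ↦ (b.repr (e (b (Sum.inr l)))) (Sum.inl i)) 0
      (LinearMap.toMatrix bQ bQ (W.mapQ W e he)) by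
    rw [← LinearMap.charpoly_toMatrix e b, this, Matrix.charpoly_fromBlocks_zero₂₁,
      LinearMap.charpoly_toMatrix, LinearMap.charpoly_toMatrix]
  ext (i | j) (k | l)
  · simp only [b, Module.Basis.sumQuot_inl, Matrix.fromBlocks_apply₁₁, LinearMap.toMatrix_apply]
    apply Module.Basis.sumQuot_repr_inl_of_mem
  · simp [LinearMap.toMatrix_apply]
  · suffices W.mkQ (e (bW k)) = 0 by simp [LinearMap.toMatrix_apply, b, this]
    rw [← LinearMap.mem_ker, Submodule.ker_mkQ]
    exact he (Submodule.coe_mem (bW k))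
  · simp only [LinearMap.toMatrix_apply, Module.Basis.sumQuot_repr_inr,
      Matrix.fromBlocks_apply₂₂, b]
    rw [← Module.Basis.sumQuot_inr bW bQ l, W.mapQ_apply]
    simp

/-- An irreducible factor of the characteristic polynomial divides every annihilating
polynomial. -/
theorem LinearMap.dvd_of_irreducible_of_dvd_charpoly
    {F V : Type*} [Field F] [AddCommGroup V] [Module F V] [Module.Finite F V]
    (f : Module.End F V) {p q : F[X]} (hq : Irreducible q) (hqf : q ∣ LinearMap.charpoly f)
    (hp : aeval f p = 0) : q ∣ p := by
  have := Fact.mk hq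
  let K := AdjoinRoot q
  let f' := Module.End.baseChangeHom F K V f
  have hroot : f'.HasEigenvalue (AdjoinRoot.root q) := by
    rw [Module.End.hasEigenvalue_iff_isRoot_charpoly]
    change ((LinearMap.baseChange K f).charpoly).IsRoot _
    rw [LinearMap.charpoly_baseChange, IsRoot, eval_map_algebraMap, AdjoinRoot.aeval_eq,
      AdjoinRoot.mk_eq_zero]
    exact hqf
  have hp' : aeval f' (p.map (algebraMap F K)) = 0 := by
    rw [aeval_map_algebraMap, aeval_algHom_apply, hp, map_zero]
  obtain ⟨v, hv⟩ := hroot.exists_hasEigenvector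
  have h := Module.End.aeval_apply_of_hasEigenvector (p := p.map (algebraMap F K)) hv
  rw [hp', LinearMap.zero_apply, eval_map_algebraMap, AdjoinRoot.aeval_eq] at h
  exact AdjoinRoot.mk_eq_zero.mp ((smul_eq_zero.mp h.symm).resolve_right hv.2)

/-- An endomorphism annihilated by a monic irreducible polynomial `p` has a power of `p` as
characteristic polynomial. -/
theorem LinearMap.exists_charpoly_eq_pow
    {F V : Type*} [Field F] [AddCommGroup V] [Module F V] [Module.Finite F V]
    (f : Module.End F V) {p : F[X]} (hp : Irreducible p) (hpm : p.Monic)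
    (hpf : aeval f p = 0) : ∃ k, LinearMap.charpoly f = p ^ k := by
  have hf : (LinearMap.charpoly f).Monic := LinearMap.charpoly_monic f
  obtain ⟨c, hc, hpc⟩ := (finiteMultiplicity_of_degree_pos_of_monic hp.degree_pos hpm
    hf.ne_zero).exists_eq_pow_mul_and_not_dvd
  refine ⟨multiplicity p (LinearMap.charpoly f), ?_⟩
  have hcm : c.Monic := (hpm.pow _).of_mul_monic_left (hc ▸ hf)
  suffices hcu : IsUnit c by rw [hcm.eq_one_of_isUnit hcu, mul_one] at hc; exact hc
  by_contra hcu
  obtain ⟨q, hq, hqc⟩ := WfDvdMonoid.exists_irreducible_factor hcu hcm.ne_zero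
  have hqp : q ∣ p := LinearMap.dvd_of_irreducible_of_dvd_charpoly f hq
    (hc ▸ hqc.mul_left _) hpf
  exact hpc ((hq.dvd_symm hp hqp).trans hqc)

/-- If `B` is a finite simple `K`-algebra of dimension `n²`, then the `K`-dimension of every
`B`-module, expressed over a subfield `F` of `K`, is divisible by `n`. -/
theorem IsSimpleRing.finrank_mul_dvd_finrank
    (F K : Type*) {B M : Type*} [Field F] [Field K] [Ring B] [Algebra F K] [Algebra F B]
    [Algebra K B] [IsScalarTower F K B] [IsSimpleRing B] [Module.Finite K B] [Module.Finite F K]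
    [AddCommGroup M] [Module F M] [Module B M] [IsScalarTower F B M] [Module.Finite B M]
    {n : ℕ} (hn : 0 < n) (hB : Module.finrank K B = n ^ 2) :
    Module.finrank F K * n ∣ Module.finrank F M := by
  have : IsArtinianRing B := IsArtinianRing.of_finite K B
  have hBB := IsSimpleRing.isIsotypic B B
  obtain ⟨s, hs, S, hS, ⟨e⟩⟩ := hBB.linearEquiv_fun
  have hMS : IsIsotypicOfType B M S := fun N _ ↦ by
    obtain ⟨I, ⟨eI⟩⟩ := IsSemisimpleRing.exists_linearEquiv_ideal_of_isSimpleModule B N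
    have := IsSimpleModule.congr eI.symm
    obtain ⟨eS⟩ := hBB S I
    exact ⟨eI.trans eS⟩
  obtain ⟨m, ⟨eM⟩⟩ := hMS.linearEquiv_fun
  have hend : Module.finrank K B = s * s * Module.finrank K (Module.End B S) := by
    have e' := ((MulOpposite.opLinearEquiv K (M := B)).trans
      (AlgEquiv.moduleEndSelf K).toLinearEquiv).trans
      ((e.conjAlgEquiv K).trans (endVecAlgEquivMatrixEnd (Fin s) K B S)).toLinearEquiv
    rw [e'.finrank_eq, Module.finrank_matrix, Fintype.card_fin]
  have hdimB : Module.finrank K B = s * Module.finrank K S := by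
    rw [(e.restrictScalars K).finrank_eq, Module.finrank_pi_fintype]; simp
  have hdimM : Module.finrank F M = m * Module.finrank F S := by
    have : Module.Finite K S := inferInstanceAs (Module.Finite K (S.restrictScalars K))
    have : Module.Finite F S := Module.Finite.trans K S
    rw [(eM.restrictScalars F).finrank_eq, Module.finrank_pi_fintype]; simp
  rw [hdimM, ← Module.finrank_mul_finrank F K S]
  refine Dvd.dvd.mul_left (mul_dvd_mul_left _ ?_) _
  rw [hB] at hend hdimB
  obtain ⟨t, rfl⟩ : s ∣ n := by
    rw [← Nat.pow_dvd_pow_iff two_ne_zero, hend, sq]; exact dvd_mul_right _ _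
  have hs' : 0 < s := Nat.pos_of_ne_zero hs.out
  refine ⟨t, Nat.eq_of_mul_eq_mul_left hs' ?_⟩
  rw [← hdimB]; ring

/-- Every linear endomorphism of a central simple algebra is a sum of maps `x ↦ a * x * b`. -/
theorem Algebra.IsCentral.mulLeftRight_surjective
    (F A : Type*) [Field F] [Ring A] [Algebra F A] [Algebra.IsCentral F A] [IsSimpleRing A]
    [FiniteDimensional F A] : Function.Surjective (AlgHom.mulLeftRight F A) := by
  let _ : Module (A ⊗[F] Aᵐᵒᵖ) A := TensorProduct.Algebra.module
  have hsmul (r : A ⊗[F] Aᵐᵒᵖ) (x : A) : r • x = AlgHom.mulLeftRight F A r x := rfl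
  have : IsSimpleModule (A ⊗[F] Aᵐᵒᵖ) A := by
    rw [isSimpleModule_iff_toSpanSingleton_surjective]
    refine ⟨inferInstance, fun x hx ↦ ?_⟩
    rw [← LinearMap.range_eq_top]
    set N := LinearMap.range (LinearMap.toSpanSingleton (A ⊗[F] Aᵐᵒᵖ) A x)
    have hN (a b y : A) (hy : y ∈ N) : a * y * b ∈ N := by
      simpa [hsmul] using N.smul_mem (a ⊗ₜ MulOpposite.op b) hy
    let I : TwoSidedIdeal A := .mk' N N.zero_mem N.add_mem N.neg_mem
      (fun {a y} hy ↦ by simpa using hN a 1 y hy) (fun {y b} hy ↦ by simpa using hN 1 b y hy)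
    have h1 : (1 : A) ∈ I := IsSimpleRing.one_mem_of_ne_zero_mem I hx
      ((TwoSidedIdeal.mem_mk' ..).mpr ⟨1, by simp⟩)
    have h1' : (1 : A) ∈ N := (TwoSidedIdeal.mem_mk' ..).mp h1
    exact (Submodule.eq_top_iff' (p := N)).mpr fun y ↦ by simpa using hN y 1 1 h1'
  classical
  intro f
  have hcomm (φ : Module.End (A ⊗[F] Aᵐᵒᵖ) A) : ∃ c : F, ∀ x, φ x = c • x := by
    have hl (a x : A) : φ (a * x) = a * φ x := by
      simpa [hsmul] using φ.map_smul (a ⊗ₜ MulOpposite.op 1) x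
    have hr (b x : A) : φ (x * b) = φ x * b := by
      simpa [hsmul] using φ.map_smul (1 ⊗ₜ MulOpposite.op b) x
    have : φ 1 ∈ Subalgebra.center F A := Subalgebra.mem_center_iff.mpr fun a ↦ by
      rw [← hl, ← hr, mul_one, one_mul]
    obtain ⟨c, hc⟩ := Algebra.IsCentral.mem_center_iff F |>.mp this
    exact ⟨c, fun x ↦ by rw [← one_mul x, hr, hc, Algebra.smul_def, one_mul]⟩
  let f' : Module.End (Module.End (A ⊗[F] Aᵐᵒᵖ) A) A :=
    { f with
      map_smul' := fun φ x ↦ by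
        obtain ⟨c, hc⟩ := hcomm φ
        simp [hc] }
  let b := Module.finBasis F A
  obtain ⟨r, hr⟩ := jacobson_density f' (Finset.univ.image b)
  exact ⟨r, b.ext fun i ↦ (hr (b i) (by simp)).symm⟩

/-- A central simple algebra remains simple after extension of scalars. -/
theorem IsSimpleRing.tensorProduct
    (F K A : Type*) [Field F] [Field K] [Algebra F K] [Ring A] [Algebra F A]
    [Algebra.IsCentral F A] [IsSimpleRing A] [FiniteDimensional F A] :
    IsSimpleRing (K ⊗[F] A) := by
  refine isSimpleRing_iff_isTwoSided_imp.mpr ⟨inferInstance, fun I hI ↦ ?_⟩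
  refine or_iff_not_imp_left.mpr fun hI0 ↦ ?_
  obtain ⟨x, hxI, hx0⟩ := Submodule.exists_mem_ne_zero_of_ne_bot hI0
  have hmem (φ : Module.End F A) : φ.baseChange K x ∈ I := by
    obtain ⟨r, rfl⟩ := Algebra.IsCentral.mulLeftRight_surjective F A φ
    induction r with
    | zero => simp
    | add r s hr hs => simpa [LinearMap.baseChange_add] using I.add_mem hr hs
    | tmul a b =>
      have : (AlgHom.mulLeftRight F A (a ⊗ₜ b)).baseChange K x =
          (1 ⊗ₜ a) * x * (1 ⊗ₜ b.unop) := by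
        clear hxI hx0
        induction x with
        | zero => simp
        | add x y hx hy => simp [hx, hy, mul_add, add_mul]
        | tmul k y => simp
      rw [this]
      exact I.mul_mem_right _ (I.mul_mem_left _ hxI)
  let b := Module.finBasis F A
  let b' := Algebra.TensorProduct.basis K b
  obtain ⟨i, hi⟩ : ∃ i, b'.repr x i ≠ 0 := by
    by_contra! h
    exact hx0 (b'.repr.map_eq_zero_iff.mp (Finsupp.ext h))
  have hφ : ((b.coord i).smulRight (1 : A)).baseChange K x = (b'.repr x i) ⊗ₜ 1 := by
    clear hxI hx0 hmem hi
    induction x with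
    | zero => simp
    | add x y hx hy => simp [hx, hy, TensorProduct.add_tmul]
    | tmul k y =>
      rw [LinearMap.baseChange_tmul, LinearMap.smulRight_apply, ← TensorProduct.smul_tmul,
        Algebra.TensorProduct.basis_repr_tmul]
      simp [Algebra.smul_def, mul_comm]
  refine (Ideal.eq_top_iff_one I).mpr ?_
  have := I.mul_mem_left ((b'.repr x i)⁻¹ ⊗ₜ 1) (hφ ▸ hmem _)
  simpa [hi, Algebra.TensorProduct.one_def] using this

/-- Restriction of scalars as an algebra homomorphism between endomorphism algebras. -/
def Module.End.restrictScalarsAlgHom (F A M : Type*) [CommSemiring F] [Semiring A] [Algebra F A]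
    [AddCommMonoid M] [Module F M] [Module A M] [IsScalarTower F A M] :
    Module.End A M →ₐ[F] Module.End F M where
  toFun f := f.restrictScalars F
  map_one' := rfl
  map_mul' _ _ := rfl
  map_zero' := rfl
  map_add' _ _ := rfl
  commutes' _ := rfl

section CentralSimple

variable {F A : Type*} [Field F] [Ring A] [Algebra F A] [Algebra.IsCentral F A] [IsSimpleRing A]
  [FiniteDimensional F A]

/-- If an endomorphism of a module over a central simple algebra of dimension `n²` is annihilated
by an irreducible polynomial `p`, then the dimension of the module is divisible by
`n * p.natDegree`. -/
theorem Algebra.IsCentral.natDegree_mul_dvd_finrank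
    {M : Type*} [AddCommGroup M] [Module F M] [Module A M] [IsScalarTower F A M]
    [FiniteDimensional F M] {n : ℕ} (hn : 0 < n) (hdim : Module.finrank F A = n ^ 2)
    (f : Module.End A M) {p : F[X]} (hp : Irreducible p) (hpf : aeval f p = 0) :
    p.natDegree * n ∣ Module.finrank F M := by
  have := Fact.mk hp
  let ψ : AdjoinRoot p →ₐ[F] Module.End A M :=
    Ideal.Quotient.liftₐ (Ideal.span {p}) (aeval f) fun a ha ↦ by
      obtain ⟨c, rfl⟩ := Ideal.mem_span_singleton.mp ha
      rw [map_mul, hpf, zero_mul]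
  let φ : AdjoinRoot p ⊗[F] A →ₐ[F] Module.End F M :=
    Algebra.TensorProduct.lift ((Module.End.restrictScalarsAlgHom F A M).comp ψ) (Algebra.lsmul F F M)
      fun x a ↦
      LinearMap.ext fun v ↦ show ψ x (a • v) = a • ψ x v from (ψ x).map_smul a v
  let _ : Module (AdjoinRoot p ⊗[F] A) M := Module.compHom M φ.toRingHom
  have : IsScalarTower F (AdjoinRoot p ⊗[F] A) M := ⟨fun c x v ↦ by
    change φ (c • x) v = c • φ x v
    rw [map_smul, LinearMap.smul_apply]⟩
  have := IsSimpleRing.tensorProduct F (AdjoinRoot p) A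
  have : Module.Finite F (AdjoinRoot p) := (AdjoinRoot.powerBasis hp.ne_zero).finite
  have : Module.Finite (AdjoinRoot p ⊗[F] A) M := .of_restrictScalars_finite F _ _
  have h := IsSimpleRing.finrank_mul_dvd_finrank F (AdjoinRoot p) (B := AdjoinRoot p ⊗[F] A)
    (M := M) hn (by rw [Module.finrank_baseChange, hdim])
  rwa [(AdjoinRoot.powerBasis hp.ne_zero).finrank, AdjoinRoot.powerBasis_dim] at h

/-- The characteristic polynomial of an endomorphism of a finite module over a central simple
algebra of dimension `n²` is an `n`-th power. -/
theorem Algebra.IsCentral.exists_charpoly_eq_pow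
    {M : Type*} [AddCommGroup M] [Module F M] [Module A M] [IsScalarTower F A M]
    [FiniteDimensional F M] {n : ℕ} (hn : 0 < n) (hdim : Module.finrank F A = n ^ 2)
    (f : Module.End A M) :
    ∃ P : F[X], P.Monic ∧ (f.restrictScalars F).charpoly = P ^ n := by
  induction hd : Module.finrank F M using Nat.strong_induction_on generalizing M with
  | _ d ih =>
  subst hd
  let ρ := Module.End.restrictScalarsAlgHom F A M
  have hρ : Function.Injective ρ := LinearMap.restrictScalars_injective F
  rcases subsingleton_or_nontrivial M with hM | hM
  · refine ⟨1, monic_one, ?_⟩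
    rw [one_pow]
    refine (LinearMap.charpoly_monic _).natDegree_eq_zero.mp ?_
    rw [LinearMap.charpoly_natDegree, Module.finrank_zero_of_subsingleton]
  have hint : IsIntegral F (ρ f) := Algebra.IsIntegral.isIntegral _
  obtain ⟨p, hpm, hp, q, hq⟩ := exists_monic_irreducible_factor (minpoly F (ρ f))
    (minpoly.not_isUnit F _)
  have hker : LinearMap.ker (aeval f p) ≠ ⊥ := fun h ↦ by
    have hq0 : aeval f q = 0 := by
      have h0 : aeval f p * aeval f q = 0 := by
        rw [← map_mul, ← hq]
        apply hρ
        rw [map_zero, ← aeval_algHom_apply, minpoly.aeval]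
      exact LinearMap.ext fun v ↦ LinearMap.ker_eq_bot.mp h
        (by simpa using LinearMap.congr_fun h0 v)
    have hdvd : minpoly F (ρ f) ∣ q := minpoly.dvd F _ (by rw [aeval_algHom_apply, hq0, map_zero])
    have hq_ne : q ≠ 0 := by rintro rfl; exact minpoly.ne_zero hint (by rw [hq, mul_zero])
    have := natDegree_le_of_dvd hdvd hq_ne
    rw [hq, natDegree_mul hp.ne_zero hq_ne] at this
    have := hp.natDegree_pos
    omega
  set N := LinearMap.ker (aeval f p) with hN
  have hNf : N ≤ N.comap f := fun v hv ↦ by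
    have : aeval f p * f = f * aeval f p := by
      simpa using (Commute.all p X).map (aeval f) |>.eq
    rw [Submodule.mem_comap, hN, LinearMap.mem_ker]
    exact (LinearMap.congr_fun this v).trans (by simp [LinearMap.mem_ker.mp hv])
  have : FiniteDimensional F N := inferInstanceAs (FiniteDimensional F (N.restrictScalars F))
  have : FiniteDimensional F (M ⧸ N) := .of_surjective (N.mkQ.restrictScalars F) N.mkQ_surjective
  let W := N.restrictScalars F
  have hsplit : (f.restrictScalars F).charpoly =
      ((f.restrict hNf).restrictScalars F).charpoly *
        ((N.mapQ N f hNf).restrictScalars F).charpoly := by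
    rw [LinearMap.charpoly_eq_charpoly_restrict_mul_charpoly_mapQ W (f.restrictScalars F) hNf,
      ← LinearEquiv.charpoly_conj (Submodule.Quotient.restrictScalarsEquiv F N)]
    congr 2
    refine LinearMap.ext fun v ↦ ?_
    obtain ⟨v, rfl⟩ := N.mkQ_surjective v
    rfl
  let fN : Module.End A N := f.restrict hNf
  have hfN (r : F[X]) (v : N) : (aeval fN r v : M) = aeval f r (v : M) := by
    induction r using Polynomial.induction_on generalizing v with
    | C a => simp [Algebra.algebraMap_eq_smul_one]
    | add r s hr hs => simp [hr, hs]
    | monomial m a h =>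
      rw [pow_succ, ← mul_assoc, map_mul, map_mul _ _ X, aeval_X, aeval_X, Module.End.mul_apply, h]
      rfl
  have hpN : aeval fN p = 0 := LinearMap.ext fun v ↦
    Subtype.ext ((hfN p v).trans (LinearMap.mem_ker.mp v.2))
  obtain ⟨k, hk⟩ := LinearMap.exists_charpoly_eq_pow
    (Module.End.restrictScalarsAlgHom F A N fN) hp hpm
    (by rw [aeval_algHom_apply, hpN, map_zero])
  obtain ⟨j, rfl⟩ : n ∣ k := by
    have h := Algebra.IsCentral.natDegree_mul_dvd_finrank hn hdim _ hp hpN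
    rw [← LinearMap.charpoly_natDegree, hk, natDegree_pow, mul_comm k] at h
    exact Nat.dvd_of_mul_dvd_mul_left hp.natDegree_pos h
  have hlt : Module.finrank F (M ⧸ N) < Module.finrank F M := by
    have h := Submodule.finrank_quotient_add_finrank W
    rw [(Submodule.Quotient.restrictScalarsEquiv F N).finrank_eq] at h
    have : 0 < Module.finrank F W := by
      have : Nontrivial W := (Submodule.nontrivial_iff_ne_bot (p := N)).mpr hker
      exact Module.finrank_pos
    omega
  obtain ⟨P, hP, hPQ⟩ := ih _ hlt (N.mapQ N f hNf) rfl
  refine ⟨p ^ j * P, (hpm.pow j).mul hP, ?_⟩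
  rw [hsplit, hPQ, mul_pow, ← pow_mul, mul_comm j]
  exact congrArg (· * P ^ n) hk

end CentralSimple

/-- In a central simple algebra of dimension `n²`, the characteristic polynomial of left
multiplication by any element is the `n`-th power of a monic polynomial of degree `n`. -/
theorem charpoly_mulLeft_eq_pow
    {F A : Type*} [Field F] [Ring A] [Algebra F A]
    [Algebra.IsCentral F A] [IsSimpleRing A] [FiniteDimensional F A]
    (n : ℕ) (hn : 0 < n) (hdim : Module.finrank F A = n ^ 2)
    (g : A) :
    ∃ P : F[X], P.Monic ∧ P.natDegree = n ∧
      (LinearMap.mulLeft F g).charpoly = P ^ n := by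
  have hop : Module.finrank F Aᵐᵒᵖ = n ^ 2 :=
    (MulOpposite.opLinearEquiv F (M := A)).finrank_eq.symm.trans hdim
  obtain ⟨P, hP, h⟩ := Algebra.IsCentral.exists_charpoly_eq_pow hn hop
    (Module.toModuleEnd Aᵐᵒᵖ A g)
  have h' : (LinearMap.mulLeft F g).charpoly = P ^ n := h
  refine ⟨P, hP, Nat.eq_of_mul_eq_mul_left hn ?_, h'⟩
  rw [← natDegree_pow, ← h', LinearMap.charpoly_natDegree, hdim, sq]
end

section
/- Let F be a field, A a finite-dimensional central simple algebra over F, E a field extension of F, and n a natural number. Let ι₁, ι₂ : A → M_n(E) be two F-algebra homomorphisms into the algebra of n×n matrices over E. Then for every g ∈ A, the characteristic polynomial of the matrix ι₁(g) equals the characteristic polynomial of the matrix ι₂(g). -/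
open Polynomial

open scoped TensorProduct

section SimpleBaseChange

variable {F E A κ : Type*} [DecidableEq κ] [Field F] [Field E] [Algebra F E] [Ring A] [Algebra F A]

lemma equivFinsuppOfBasisLeft_one_tmul_mul (b : Module.Basis κ F E) (a : A) (y : E ⊗[F] A)
    (i : κ) :
    TensorProduct.equivFinsuppOfBasisLeft b ((1 ⊗ₜ a) * y) i =
      a * TensorProduct.equivFinsuppOfBasisLeft b y i := by
  induction y using TensorProduct.induction_on with
  | zero => simp
  | tmul c d => simp
  | add y z hy hz => simp [mul_add, hy, hz]

lemma equivFinsuppOfBasisLeft_mul_one_tmul (b : Module.Basis κ F E) (a : A) (y : E ⊗[F] A)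
    (i : κ) :
    TensorProduct.equivFinsuppOfBasisLeft b (y * (1 ⊗ₜ a)) i =
      TensorProduct.equivFinsuppOfBasisLeft b y i * a := by
  induction y using TensorProduct.induction_on with
  | zero => simp
  | tmul c d => simp
  | add y z hy hz => simp [add_mul, hy, hz]

/-- For central `A`, an element of `E ⊗[F] A` that commutes with `A` comes from `E`. -/
lemma exists_eq_tmul_one_of_commute [Algebra.IsCentral F A] (b : Module.Basis κ F E)
    (y : E ⊗[F] A) (hy : ∀ a : A, (1 ⊗ₜ a) * y = y * (1 ⊗ₜ a)) : ∃ c : E, y = c ⊗ₜ 1 := by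
  have hmem (i : κ) : ∃ r : F, algebraMap F A r = TensorProduct.equivFinsuppOfBasisLeft b y i := by
    apply Algebra.mem_bot.mp
    apply Algebra.IsCentral.out
    rw [Subalgebra.mem_center_iff]
    intro a
    rw [← equivFinsuppOfBasisLeft_one_tmul_mul, hy, equivFinsuppOfBasisLeft_mul_one_tmul]
  choose r hr using hmem
  refine ⟨(TensorProduct.equivFinsuppOfBasisLeft b y).sum fun i _ ↦ r i • b i, ?_⟩
  conv_lhs => rw [← (TensorProduct.equivFinsuppOfBasisLeft b).symm_apply_apply y]
  rw [TensorProduct.equivFinsuppOfBasisLeft_symm_apply, Finsupp.sum, Finsupp.sum,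
    TensorProduct.sum_tmul]
  refine Finset.sum_congr rfl fun i _ ↦ ?_
  rw [← hr i, Algebra.algebraMap_eq_smul_one, TensorProduct.tmul_smul, TensorProduct.smul_tmul']

/-- The base change of a central simple algebra to a field extension is simple. -/
theorem isSimpleRing_baseChange [Algebra.IsCentral F A] [IsSimpleRing A] :
    IsSimpleRing (E ⊗[F] A) := by
  classical
  let b := Module.Basis.ofVectorSpace F E
  let T := TensorProduct.equivFinsuppOfBasisLeft (N := A) b
  have hT : ∀ y, (∀ i, T y i = 0) → y = 0 := fun y hy ↦
    T.map_eq_zero_iff.mp (Finsupp.ext hy)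
  refine .of_eq_bot_or_eq_top fun I ↦ or_iff_not_imp_left.mpr fun hI ↦ ?_
  obtain ⟨x, ⟨hxI, hx0⟩, hmin⟩ : ∃ x, (x ∈ I ∧ x ≠ 0) ∧
      ∀ y, y ∈ I → (T y).support.card < (T x).support.card → y = 0 := by
    have hne : {x | x ∈ I ∧ x ≠ 0}.Nonempty := by
      by_contra h
      refine hI (le_bot_iff.mp fun x hx ↦ ?_)
      by_contra hx0
      exact h ⟨x, hx, fun h0 ↦ hx0 (h0 ▸ zero_mem _)⟩
    obtain ⟨x, hx, hm⟩ := (measure fun x ↦ (T x).support.card).wf.has_min _ hne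
    exact ⟨x, hx, fun y hy hlt ↦ by_contra fun h0 ↦ hm y ⟨hy, h0⟩ hlt⟩
  obtain ⟨i₀, hi₀⟩ : ∃ i, T x i ≠ 0 := by
    by_contra! h
    exact hx0 (hT x h)
  let J : TwoSidedIdeal A := .mk' {a | ∃ y ∈ I, (∀ i, T x i = 0 → T y i = 0) ∧ T y i₀ = a}
    ⟨0, zero_mem I, by simp, by simp⟩
    (by
      rintro _ _ ⟨y, hy, hy', rfl⟩ ⟨z, hz, hz', rfl⟩
      exact ⟨y + z, add_mem hy hz, fun i hi ↦ by simp [hy' i hi, hz' i hi], by simp⟩)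
    (by
      rintro _ ⟨y, hy, hy', rfl⟩
      exact ⟨-y, neg_mem hy, fun i hi ↦ by simp [hy' i hi], by simp⟩)
    (by
      rintro a _ ⟨y, hy, hy', rfl⟩
      exact ⟨(1 ⊗ₜ a) * y, I.mul_mem_left _ _ hy,
        fun i hi ↦ (equivFinsuppOfBasisLeft_one_tmul_mul b a y i).trans <| by
          rw [show TensorProduct.equivFinsuppOfBasisLeft b y i = 0 from hy' i hi, mul_zero],
        equivFinsuppOfBasisLeft_one_tmul_mul ..⟩)
    (by
      rintro _ a ⟨y, hy, hy', rfl⟩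
      exact ⟨y * (1 ⊗ₜ a), I.mul_mem_right _ _ hy,
        fun i hi ↦ (equivFinsuppOfBasisLeft_mul_one_tmul b a y i).trans <| by
          rw [show TensorProduct.equivFinsuppOfBasisLeft b y i = 0 from hy' i hi, zero_mul],
        equivFinsuppOfBasisLeft_mul_one_tmul ..⟩)
  have hJ : (1 : A) ∈ J := IsSimpleRing.one_mem_of_ne_zero_mem J hi₀ <|
    (TwoSidedIdeal.mem_mk' ..).mpr ⟨x, hxI, fun _ ↦ id, rfl⟩
  obtain ⟨y, hyI, hyx, hy1⟩ := (TwoSidedIdeal.mem_mk' ..).mp hJ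
  obtain ⟨c, rfl⟩ := exists_eq_tmul_one_of_commute b y fun a ↦ by
    have hco (i : _) : T ((1 ⊗ₜ a) * y - y * (1 ⊗ₜ a)) i = a * T y i - T y i * a := by
      rw [map_sub, Finsupp.sub_apply]
      exact congrArg₂ _ (equivFinsuppOfBasisLeft_one_tmul_mul ..)
        (equivFinsuppOfBasisLeft_mul_one_tmul ..)
    refine sub_eq_zero.mp (hmin _ (sub_mem (I.mul_mem_left _ _ hyI) (I.mul_mem_right _ _ hyI)) ?_)
    refine Finset.card_lt_card (Finset.ssubset_iff_of_subset ?_ |>.mpr ⟨i₀, ?_, ?_⟩)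
    · intro i
      simp only [Finsupp.mem_support_iff, hco]
      exact mt fun hi ↦ by simp [hyx i hi]
    · simpa using hi₀
    · rw [Finsupp.notMem_support_iff, hco, hy1, mul_one, one_mul, sub_self]
  have hc : c ≠ 0 := by
    rintro rfl
    simp at hy1
  rw [← I.one_mem_iff]
  simpa [hc, Algebra.TensorProduct.one_def] using I.mul_mem_left (c⁻¹ ⊗ₜ 1) _ hyI

end SimpleBaseChange

/-- Two finite-dimensional representations of the same dimension of a finite-dimensional simple
algebra are isomorphic. -/
theorem IsSimpleRing.exists_linearEquiv_intertwining {K B V W : Type*} [Field K] [Ring B]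
    [Algebra K B] [IsSimpleRing B] [FiniteDimensional K B]
    [AddCommGroup V] [Module K V] [FiniteDimensional K V]
    [AddCommGroup W] [Module K W] [FiniteDimensional K W]
    (h : Module.finrank K V = Module.finrank K W)
    (ρ : B →ₐ[K] Module.End K V) (σ : B →ₐ[K] Module.End K W) :
    ∃ e : V ≃ₗ[K] W, ∀ b v, e (ρ b v) = σ b (e v) := by
  cases subsingleton_or_nontrivial V with
  | inl hV =>
    have hW : Subsingleton W := by
      rw [← Module.finrank_zero_iff (R := K), ← h, Module.finrank_zero_of_subsingleton]
    exact ⟨0, fun _ _ ↦ Subsingleton.elim _ _⟩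
  | inr hV =>
    let : Module B V := Module.compHom V ρ.toRingHom
    let : Module B W := Module.compHom W σ.toRingHom
    have : IsScalarTower K B V := ⟨fun k b v ↦ LinearMap.congr_fun (map_smul ρ k b) v⟩
    have : IsScalarTower K B W := ⟨fun k b v ↦ LinearMap.congr_fun (map_smul σ k b) v⟩
    have : IsArtinianRing B := .of_finite K B
    have : Module.Finite B V := .of_restrictScalars_finite K B V
    have : Module.Finite B W := .of_restrictScalars_finite K B W
    have hVW := IsSimpleRing.isIsotypic B (V × W)
    obtain ⟨_, _, S, hS, -⟩ := hVW.linearEquiv_fun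
    obtain ⟨k, ⟨e₁⟩⟩ := ((hVW S).of_injective (LinearMap.inl B V W)
      LinearMap.inl_injective).linearEquiv_fun
    obtain ⟨l, ⟨e₂⟩⟩ := ((hVW S).of_injective (LinearMap.inr B V W)
      LinearMap.inr_injective).linearEquiv_fun
    have : Nontrivial S := IsSimpleModule.nontrivial B S
    have : FiniteDimensional K S :=
      inferInstanceAs (FiniteDimensional K (S.restrictScalars K))
    obtain rfl : k = l := by
      rw [(e₁.restrictScalars K).finrank_eq, (e₂.restrictScalars K).finrank_eq,
        Module.finrank_pi_fintype, Module.finrank_pi_fintype] at h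
      simpa [(Module.finrank_pos (R := K) (M := S)).ne'] using h
    let e := e₁.trans e₂.symm
    exact ⟨e.restrictScalars K, fun b v ↦ e.map_smul b v⟩

/-- Matrix representations of the same size of a finite-dimensional simple algebra have the same
characteristic polynomials. -/
theorem IsSimpleRing.charpoly_algHom_eq {K B m : Type*} [Field K] [Ring B]
    [Algebra K B] [IsSimpleRing B] [FiniteDimensional K B] [Fintype m] [DecidableEq m]
    (ρ σ : B →ₐ[K] Matrix m m K) (b : B) : (ρ b).charpoly = (σ b).charpoly := by
  obtain ⟨e, he⟩ := IsSimpleRing.exists_linearEquiv_intertwining rfl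
    (Matrix.toLinAlgEquiv'.toAlgHom.comp ρ) (Matrix.toLinAlgEquiv'.toAlgHom.comp σ)
  have hconj : e.conj (Matrix.toLin' (ρ b)) = Matrix.toLin' (σ b) := by
    refine LinearMap.ext fun v ↦ ?_
    rw [LinearEquiv.conj_apply_apply]
    simpa using! he b (e.symm v)
  rw [← Matrix.charpoly_toLin' (ρ b), ← Matrix.charpoly_toLin' (σ b), ← hconj,
    LinearEquiv.charpoly_conj]

/-- The characteristic polynomial of the image of an element of a finite-dimensional central
simple algebra under an `F`-algebra embedding into a matrix algebra over a field extension
does not depend on the choice of the embedding. -/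
theorem charpoly_indep_of_embedding
    {F A E : Type*} [Field F] [Ring A] [Algebra F A]
    [Algebra.IsCentral F A] [IsSimpleRing A] [FiniteDimensional F A]
    [Field E] [Algebra F E] (n : ℕ)
    (ι₁ ι₂ : A →ₐ[F] Matrix (Fin n) (Fin n) E) (g : A) :
    (ι₁ g).charpoly = (ι₂ g).charpoly := by
  have := isSimpleRing_baseChange (F := F) (E := E) (A := A)
  let ext (ι : A →ₐ[F] Matrix (Fin n) (Fin n) E) : E ⊗[F] A →ₐ[E] Matrix (Fin n) (Fin n) E :=
    Algebra.TensorProduct.lift (Algebra.ofId E _) ι fun c _ ↦ Algebra.commutes c _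
  have h_ext (ι : A →ₐ[F] Matrix (Fin n) (Fin n) E) : ext ι (1 ⊗ₜ g) = ι g :=
    (Algebra.TensorProduct.lift_tmul ..).trans (by rw [map_one, one_mul])
  simpa only [h_ext] using IsSimpleRing.charpoly_algHom_eq (ext ι₁) (ext ι₂) (1 ⊗ₜ g)
end

section
/- Let F be a field and let A be a finite-dimensional central simple algebra over F with dim_F A = n² for a positive integer n. Let E be a field extension of F and let ι : A → M_n(E) be an F-algebra homomorphism into the algebra of n×n matrices over E. Then for every g ∈ A there exists a monic polynomial P ∈ F[X] of degree n such that: (i) the image of P under the coefficient map F[X] → E[X] equals the characteristic polynomial of the matrix ι(g), and (ii) the characteristic polynomial of the F-linear endomorphism of A given by left multiplication by g equals P^n. -/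
open Polynomial

/-- The bimodule endomorphisms generated by left and right multiplications exhaust all linear
endomorphisms of a central simple algebra. -/
theorem mulLeftRight_surjective_of_isCentral
    {F A : Type*} [Field F] [Ring A] [Algebra F A]
    [Algebra.IsCentral F A] [IsSimpleRing A] [FiniteDimensional F A] :
    Function.Surjective (AlgHom.mulLeftRight F A) := by
  classical
  let S : Subalgebra F (Module.End F A) := (AlgHom.mulLeftRight F A).range
  have mem (a b : A) : AlgHom.mulLeftRight F A (a ⊗ₜ MulOpposite.op b) ∈ S := ⟨_, rfl⟩
  have hS : IsSimpleModule S A := by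
    refine (isSimpleModule_iff _ _).mpr
      { exists_pair_ne := ⟨⊥, ⊤, bot_ne_top⟩, eq_bot_or_eq_top := fun N ↦ ?_ }
    have hmul (a b x : A) (hx : x ∈ N) : a * x * b ∈ N := by
      simpa [Subalgebra.smul_def] using N.smul_mem ⟨_, mem a b⟩ hx
    let I : TwoSidedIdeal A := .mk' N N.zero_mem N.add_mem (fun {x} hx ↦ by simpa using hmul (-1) 1 x hx)
      (fun {x y} hy ↦ by simpa using hmul x 1 y hy) (fun {x y} hx ↦ by simpa using hmul 1 y x hx)
    have hI (x : A) : x ∈ I ↔ x ∈ N := by simp [I]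
    rcases eq_bot_or_eq_top I with h | h
    · left
      ext x
      rw [← hI, h]; simp
    · right
      ext x
      rw [← hI, h]; simp
  intro f
  have hEnd (h : Module.End S A) : ∃ c : F, ∀ x, h x = c • x := by
    have key (a b x : A) : h (a * x * b) = a * h x * b := by
      simpa [Subalgebra.smul_def] using h.map_smul ⟨_, mem a b⟩ x
    have hl (x : A) : h x = x * h 1 := by simpa using key x 1 1
    have hr (x : A) : h x = h 1 * x := by simpa using key 1 x 1
    have hc : h 1 ∈ Subalgebra.center F A :=
      Subalgebra.mem_center_iff.mpr fun x ↦ by rw [← hl, hr]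
    obtain ⟨c, hc⟩ := (Algebra.IsCentral.mem_center_iff F).mp hc
    exact ⟨c, fun x ↦ by rw [hr, hc, Algebra.smul_def]⟩
  let f' : Module.End (Module.End S A) A :=
    { toFun := f
      map_add' := f.map_add
      map_smul' := fun h x ↦ by
        obtain ⟨c, hc⟩ := hEnd h
        simp [hc] }
  let b := Module.finBasis F A
  obtain ⟨⟨r, t, rfl⟩, hr⟩ := jacobson_density (R := S) f' (Finset.univ.image b)
  refine ⟨t, b.ext fun i ↦ ?_⟩
  exact (hr (b i) (by simp)).symm

/-- An algebra homomorphism from a central simple algebra to an algebra over an extension field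
takes a basis to a linearly independent family over the extension. -/
theorem AlgHom.linearIndependent_of_isCentral
    {F A E B κ : Type*} [Field F] [Ring A] [Algebra F A]
    [Algebra.IsCentral F A] [IsSimpleRing A] [FiniteDimensional F A]
    [Field E] [Ring B] [Nontrivial B] [Algebra F B] [Algebra E B]
    (f : A →ₐ[F] B) (v : Module.Basis κ F A) :
    LinearIndependent E (f ∘ v) := by
  classical
  rw [linearIndependent_iff']
  intro s e he k hk
  have hmul (t : TensorProduct F A Aᵐᵒᵖ) :
      ∑ i ∈ s, e i • f (AlgHom.mulLeftRight F A t (v i)) = 0 := by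
    induction t with
    | zero => simp
    | add x y hx hy => simp [smul_add, Finset.sum_add_distrib, hx, hy]
    | tmul a b =>
      have := congr(f a * $he * f b.unop)
      simpa [Finset.mul_sum, Finset.sum_mul] using this
  obtain ⟨t, ht⟩ := mulLeftRight_surjective_of_isCentral (v.constr F (Pi.single k (1 : A)))
  have := hmul t
  simp only [ht, Module.Basis.constr_basis] at this
  rw [Finset.sum_eq_single_of_mem k hk (fun i _ hi ↦ by simp [hi])] at this
  simpa using this

/-- The characteristic polynomial of left multiplication by a square matrix on square matrices. -/
theorem LinearMap.charpoly_mulLeft_matrix {R m : Type*} [CommRing R] [Fintype m]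
    [DecidableEq m] (M : Matrix m m R) :
    (LinearMap.mulLeft R M).charpoly = M.charpoly ^ Fintype.card m := by
  have h : LinearMap.toMatrix (Matrix.stdBasis R m m) (Matrix.stdBasis R m m)
      (LinearMap.mulLeft R M) = Matrix.kroneckerMap (· * ·) M (1 : Matrix m m R) := by
    ext ⟨i, j⟩ ⟨k, l⟩
    rw [LinearMap.toMatrix_apply, Matrix.stdBasis_eq_single]
    change (M * Matrix.single k l (1 : R) : Matrix m m R) i j = M i k * (1 : Matrix m m R) j l
    by_cases hjl : j = l
    · subst hjl; simp
    · simp [hjl]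
  have h' : (Matrix.kroneckerMap (· * ·) M (1 : Matrix m m R)).charmatrix =
      Matrix.kroneckerMap (· * ·) M.charmatrix (1 : Matrix m m R[X]) := by
    ext ⟨i, j⟩ ⟨k, l⟩
    simp [Matrix.charmatrix_apply, Matrix.one_apply, Matrix.diagonal_apply]
    by_cases hik : i = k <;> by_cases hjl : j = l <;> simp [hik, hjl]
  rw [← LinearMap.charpoly_toMatrix _ (Matrix.stdBasis R m m), h, Matrix.charpoly, h',
    Matrix.det_kronecker]
  simp [Matrix.charpoly]

/-- Extension of scalars of multivariate polynomials along a field extension admits a retraction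
that is linear over the polynomials with coefficients in the smaller field. -/
theorem MvPolynomial.exists_retraction (σ F E : Type*) [Field F] [Field E] [Algebra F E] :
    ∃ r : MvPolynomial σ E →+ MvPolynomial σ F, r 1 = 1 ∧
      ∀ (q : MvPolynomial σ E) (s : MvPolynomial σ F),
        r (q * MvPolynomial.map (algebraMap F E) s) = r q * s := by
  obtain ⟨ρ, hρ⟩ := (Algebra.linearMap F E).exists_leftInverse_of_injective
    (LinearMap.ker_eq_bot.mpr (algebraMap F E).injective)
  have hρ1 : ρ 1 = 1 := by simpa using congr($hρ 1)
  let e := MvPolynomial.algebraTensorAlgEquiv (σ := σ) F E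
  let r₀ : TensorProduct F E (MvPolynomial σ F) →ₗ[F] MvPolynomial σ F :=
    (TensorProduct.lid F _).toLinearMap ∘ₗ ρ.rTensor _
  refine ⟨r₀.toAddMonoidHom.comp e.symm.toRingEquiv.toAddEquiv.toAddMonoidHom, ?_, fun q s ↦ ?_⟩
  · change r₀ (e.symm 1) = 1
    simp [r₀, hρ1, Algebra.TensorProduct.one_def]
  · change r₀ (e.symm (q * _)) = r₀ (e.symm q) * s
    rw [map_mul, MvPolynomial.algebraTensorAlgEquiv_symm_map]
    induction e.symm q with
    | zero => simp
    | add x y hx hy => simp only [add_mul, map_add, hx, hy]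
    | tmul x y => simp [r₀]

/-- Linearly independent matrices stay linearly independent over a polynomial ring. -/
theorem Matrix.linearIndependent_map_C {R m n κ σ : Type*} [CommRing R] [Finite κ]
    {v : κ → Matrix m n R} (hv : LinearIndependent R v) :
    LinearIndependent (MvPolynomial σ R) (fun i ↦ (v i).map (MvPolynomial.C (σ := σ))) := by
  have := Fintype.ofFinite κ
  rw [Fintype.linearIndependent_iff] at hv ⊢
  intro g hg i
  ext d
  refine hv (fun i ↦ (g i).coeff d) ?_ i
  ext j k
  have := congr(($hg j k).coeff d)
  simpa [Matrix.sum_apply, MvPolynomial.coeff_sum, mul_comm _ (MvPolynomial.C _),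
    MvPolynomial.coeff_C_mul, mul_comm ((v _ _ _))] using this

/-- If some specialization of a matrix over a domain is the lower shift, then the powers of that
matrix below its size are linearly independent. -/
theorem Matrix.eq_zero_of_sum_smul_pow_eq_zero_of_shift {R S : Type*} [CommRing R] [IsDomain R]
    [CommRing S] [Nontrivial S] (n : ℕ) (φ : R →+* S) (M : Matrix (Fin n) (Fin n) R)
    (hM : M.map φ = Matrix.of fun i j : Fin n ↦ if (i : ℕ) = j + 1 then 1 else 0)
    (d : ℕ → R) (hd : ∑ k ∈ Finset.range n, d k • M ^ k = 0) (k : ℕ) (hk : k < n) :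
    d k = 0 := by
  have hn : NeZero n := ⟨by omega⟩
  have hpow (k : ℕ) (hk : k < n) (i : Fin n) :
      φ ((M ^ k) i 0) = if (i : ℕ) = k then 1 else 0 := by
    induction k generalizing i with
    | zero =>
      rw [pow_zero, Matrix.one_apply, apply_ite φ, map_one, map_zero]
      simp
    | succ k ih =>
      have hMi (j : Fin n) : φ (M i j) = if (i : ℕ) = j + 1 then 1 else 0 := congr($hM i j)
      rw [pow_succ', Matrix.mul_apply, map_sum,
        Finset.sum_eq_single (⟨k, by omega⟩ : Fin n)]
      · simp [hMi, ih (by omega)]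
      · intro j _ hj
        have : (j : ℕ) ≠ k := fun h ↦ hj (Fin.ext h)
        simp [ih (by omega), this]
      · simp
  let W : Matrix (Fin n) (Fin n) R := Matrix.of fun i k ↦ (M ^ (k : ℕ)) i 0
  have hW : W.det ≠ 0 := by
    intro h
    have h1 : φ.mapMatrix W = 1 := by
      ext i k
      simp [W, hpow k k.2, Matrix.one_apply, Fin.ext_iff]
    have := congr(φ $h)
    rw [RingHom.map_det, h1] at this
    simp at this
  have := Matrix.eq_zero_of_mulVec_eq_zero hW (v := fun k ↦ d k) (by
    ext i
    have := congr($hd i 0)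
    rw [Finset.sum_range] at this
    simpa [W, Matrix.mulVec, dotProduct, Matrix.sum_apply, mul_comm] using this)
  exact congr_fun this ⟨k, hk⟩

/-- The coefficients of the characteristic polynomial of the generic element of a central simple
algebra, computed in a matrix algebra over an extension field, are defined over the base field. -/
theorem charpoly_coeff_generic_mem_range
    {F A E I : Type*} [Field F] [Ring A] [Algebra F A] [Field E] [Algebra F E] [Fintype I]
    (n : ℕ) (ι : A →ₐ[F] Matrix (Fin n) (Fin n) E) (b : Module.Basis I F A)
    (β : Module.Basis I E (Matrix (Fin n) (Fin n) E)) (hβ : ∀ i, β i = ι (b i)) (k : ℕ) :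
    (∑ i, (MvPolynomial.X i : MvPolynomial I E) • (ι (b i)).map MvPolynomial.C).charpoly.coeff k ∈
      Set.range (MvPolynomial.map (σ := I) (algebraMap F E)) := by
  set Γ : Matrix (Fin n) (Fin n) (MvPolynomial I E) :=
    ∑ i, (MvPolynomial.X i : MvPolynomial I E) • (ι (b i)).map MvPolynomial.C with hΓ
  let μ := MvPolynomial.map (σ := I) (algebraMap F E)
  let j : A →+* Matrix (Fin n) (Fin n) (MvPolynomial I E) :=
    (RingHom.mapMatrix MvPolynomial.C).comp ι.toRingHom
  have hj (a : A) : j a = (ι a).map MvPolynomial.C := rfl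
  have hja (a : A) : j a = ∑ l, μ (MvPolynomial.C (b.repr a l)) • j (b l) := by
    conv_lhs => rw [← b.sum_repr a]
    ext s t
    simp [hj, μ, Matrix.sum_apply, Algebra.smul_def, Matrix.algebraMap_eq_diagonal]
  have hpow (k : ℕ) : ∃ p : I → MvPolynomial I F, Γ ^ k = ∑ l, μ (p l) • j (b l) := by
    induction k with
    | zero => exact ⟨fun l ↦ MvPolynomial.C (b.repr 1 l), by rw [pow_zero, ← hja, map_one]⟩
    | succ k ih =>
      obtain ⟨p, hp⟩ := ih
      refine ⟨fun l ↦ ∑ s, ∑ t, p s * MvPolynomial.X t *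
        MvPolynomial.C (b.repr (b s * b t) l), ?_⟩
      have hΓ' : Γ = ∑ t, μ (MvPolynomial.X t) • j (b t) := by simp [hΓ, hj, μ]
      rw [pow_succ, hp, hΓ', Finset.sum_mul_sum]
      simp only [smul_mul_smul_comm, ← map_mul j, hja (b _ * b _), Finset.smul_sum, smul_smul,
        ← map_mul μ, map_sum μ, Finset.sum_smul]
      conv_rhs => rw [Finset.sum_comm]
      exact Finset.sum_congr rfl fun _ _ ↦ Finset.sum_comm
  choose p hp using hpow
  obtain ⟨r, hr1, hr⟩ := MvPolynomial.exists_retraction I F E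
  have hli : LinearIndependent (MvPolynomial I E) (fun l ↦ j (b l)) := by
    have := Matrix.linearIndependent_map_C (σ := I) β.linearIndependent
    simpa only [hβ] using! this
  rw [Fintype.linearIndependent_iff] at hli
  let c := Γ.charpoly.coeff
  have hdeg : Γ.charpoly.natDegree = n := by simp
  have hcn : c n = 1 := by
    have := Γ.charpoly_monic.coeff_natDegree
    rwa [hdeg] at this
  have hCH : ∑ k ∈ Finset.range (n + 1), c k • Γ ^ k = 0 := by
    have := Γ.aeval_self_charpoly
    rwa [Polynomial.aeval_eq_sum_range, hdeg] at this
  have hCH' : ∑ k ∈ Finset.range (n + 1), μ (r (c k)) • Γ ^ k = 0 := by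
    have h0 (l : I) : ∑ k ∈ Finset.range (n + 1), c k * μ (p k l) = 0 := by
      refine hli (fun l ↦ ∑ k ∈ Finset.range (n + 1), c k * μ (p k l)) ?_ l
      rw [← hCH]
      simp only [hp, Finset.smul_sum, Finset.sum_smul, smul_smul]
      exact Finset.sum_comm
    have h1 (l : I) : ∑ k ∈ Finset.range (n + 1), μ (r (c k)) * μ (p k l) = 0 := by
      have := congr(μ (r $(h0 l)))
      simpa only [map_sum, μ, hr, map_mul, map_zero] using this
    simp only [hp, Finset.smul_sum, smul_smul]
    rw [Finset.sum_comm]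
    simp only [← Finset.sum_smul, h1, zero_smul, Finset.sum_const_zero]
  rcases lt_trichotomy k n with hk | rfl | hk
  · let N : Matrix (Fin n) (Fin n) E := Matrix.of fun i j ↦ if (i : ℕ) = j + 1 then 1 else 0
    have hM : Γ.map (MvPolynomial.eval fun i ↦ β.repr N i) = N := by
      conv_rhs => rw [← β.sum_repr N]
      ext s t
      simp [hΓ, Matrix.sum_apply, hβ]
    have := Matrix.eq_zero_of_sum_smul_pow_eq_zero_of_shift n
      (MvPolynomial.eval fun i ↦ β.repr N i) Γ hM (fun k ↦ c k - μ (r (c k))) (by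
        have := congr($hCH - $hCH')
        rw [Finset.sum_range_succ, Finset.sum_range_succ, hcn, hr1, map_one,
          add_sub_add_right_eq_sub, ← Finset.sum_sub_distrib] at this
        simpa only [sub_smul, sub_zero] using this) k hk
    exact ⟨r (c k), (sub_eq_zero.mp this).symm⟩
  · exact ⟨1, by rw [map_one]; exact hcn.symm⟩
  · exact ⟨0, by rw [map_zero, Polynomial.coeff_eq_zero_of_natDegree_lt (hdeg.trans_lt hk)]⟩

/-- The two definitions of the reduced characteristic polynomial of an element of a central
simple algebra of dimension `n²` agree: the characteristic polynomial computed through an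
`F`-algebra embedding into `M_n(E)` comes from a monic polynomial `P` of degree `n` with
coefficients in `F`, and the characteristic polynomial of left multiplication is `P ^ n`. -/
theorem reduced_charpoly_agree
    {F A E : Type*} [Field F] [Ring A] [Algebra F A]
    [Algebra.IsCentral F A] [IsSimpleRing A] [FiniteDimensional F A]
    [Field E] [Algebra F E]
    (n : ℕ) (hn : 0 < n) (hdim : Module.finrank F A = n ^ 2)
    (ι : A →ₐ[F] Matrix (Fin n) (Fin n) E) (g : A) :
    ∃ P : F[X], P.Monic ∧ P.natDegree = n ∧
      P.map (algebraMap F E) = (ι g).charpoly ∧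
      (LinearMap.mulLeft F g).charpoly = P ^ n := by
  have : NeZero n := ⟨hn.ne'⟩
  let b := Module.finBasisOfFinrankEq F A hdim
  let β : Module.Basis (Fin (n ^ 2)) E (Matrix (Fin n) (Fin n) E) :=
    basisOfLinearIndependentOfCardEqFinrank (ι.linearIndependent_of_isCentral b)
      (by simp [Module.finrank_matrix, sq])
  have hβ (i) : β i = ι (b i) := by simp [β]
  have hι (a : A) : ι a = ∑ l, algebraMap F E (b.repr a l) • β l := by
    conv_lhs => rw [← b.sum_repr a]
    simp only [hβ, algebraMap_smul, map_sum, map_smul]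
  have hspec : (∑ i, (MvPolynomial.X i : MvPolynomial (Fin (n ^ 2)) E) •
      (ι (b i)).map MvPolynomial.C).map
        (MvPolynomial.eval fun i ↦ algebraMap F E (b.repr g i)) = ι g := by
    rw [hι g]
    ext s t
    simp only [Matrix.sum_apply, Matrix.map_apply, Matrix.smul_apply, smul_eq_mul, map_sum, map_mul,
      MvPolynomial.eval_X, MvPolynomial.eval_C, hβ]
  have hlift : (ι g).charpoly ∈ Polynomial.lifts (algebraMap F E) := by
    rw [Polynomial.lifts_iff_coeff_lifts]
    intro k
    obtain ⟨c, hc⟩ := charpoly_coeff_generic_mem_range n ι b β hβ k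
    refine ⟨MvPolynomial.eval (b.repr g) c, ?_⟩
    rw [← hspec, Matrix.charpoly_map, Polynomial.coeff_map, ← hc, MvPolynomial.eval_map,
      MvPolynomial.eval₂_comp]
    rfl
  obtain ⟨P, hP, hPdeg, hPm⟩ :=
    Polynomial.lifts_and_natDegree_eq_and_monic hlift (ι g).charpoly_monic
  refine ⟨P, hPm, by simpa using hPdeg, hP, ?_⟩
  apply Polynomial.map_injective _ (algebraMap F E).injective
  have hmat : (LinearMap.toMatrix b b (LinearMap.mulLeft F g)).map (algebraMap F E) =
      LinearMap.toMatrix β β (LinearMap.mulLeft E (ι g)) := by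
    ext s t
    rw [Matrix.map_apply, LinearMap.toMatrix_apply, LinearMap.toMatrix_apply,
      LinearMap.mulLeft_apply, LinearMap.mulLeft_apply, hβ, ← map_mul, hι (g * b t),
      Module.Basis.repr_sum_self]
  rw [Polynomial.map_pow, hP, ← LinearMap.charpoly_toMatrix _ b, ← Matrix.charpoly_map]
  conv_lhs => rw [hmat]
  rw [LinearMap.charpoly_toMatrix, LinearMap.charpoly_mulLeft_matrix, Fintype.card_fin]
end

section
/- Let F be a field and let A be a finite-dimensional central simple algebra over F with dim_F A = n² for a positive integer n. Let g ∈ A be an element whose minimal polynomial over F is separable of degree n. Then the centralizer of g in A (as an F-subalgebra) equals the F-subalgebra generated by g: Centralizer_A(g) = F[g]. -/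
open TensorProduct Polynomial in
/-- The quotient of a polynomial ring by a separable polynomial is formally unramified. -/
theorem AdjoinRoot.formallyUnramified_of_separable {R : Type*} [CommRing R] {p : R[X]}
    (hp : p.Separable) : Algebra.FormallyUnramified R (AdjoinRoot p) := by
  rw [Algebra.FormallyUnramified.iff_comp_injective]
  intro B _ _ I hI f₁ f₂ e
  apply AdjoinRoot.algHom_ext
  set y := f₁ (AdjoinRoot.root p)
  set z := f₂ (AdjoinRoot.root p)
  have hmem : z - y ∈ I := by
    rw [← Ideal.Quotient.mk_eq_mk_iff_sub_mem]
    exact (AlgHom.congr_fun e (AdjoinRoot.root p)).symm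
  have hsq : (z - y) ^ 2 = 0 := by
    have := Ideal.pow_mem_pow hmem 2
    rwa [hI] at this
  have hroot : ∀ f : AdjoinRoot p →ₐ[R] B, aeval (f (AdjoinRoot.root p)) p = 0 := fun f => by
    rw [aeval_algHom_apply, AdjoinRoot.aeval_eq, AdjoinRoot.mk_self, map_zero]
  have hy : aeval y p = 0 := hroot f₁
  have hz : aeval z p = 0 := hroot f₂
  have htaylor := aeval_add_of_sq_eq_zero p y (z - y) hsq
  rw [add_sub_cancel, hz, hy, zero_add] at htaylor
  obtain ⟨a, b, hab⟩ := hp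
  have hone := congrArg (aeval y) hab
  simp only [map_add, map_mul, hy, mul_zero, zero_add, map_one] at hone
  have : z - y = 0 := by
    calc z - y = (aeval y b * aeval y (derivative p)) * (z - y) := by rw [hone, one_mul]
      _ = 0 := by rw [mul_assoc, ← htaylor, mul_zero]
  exact (sub_eq_zero.mp this).symm

/-- Over a central simple algebra, the two-sided multiplications `x ↦ a i * x * b i` by a linearly
independent family `a` are independent. -/
theorem LinearIndependent.eq_zero_of_sum_mul_mul_eq_zero {F A ι : Type*} [Field F] [Ring A]
    [Algebra F A] [Algebra.IsCentral F A] [IsSimpleRing A] {a : ι → A}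
    (ha : LinearIndependent F a) (s : Finset ι) (b : ι → A)
    (h : ∀ x, ∑ i ∈ s, a i * x * b i = 0) : ∀ i ∈ s, b i = 0 := by
  classical
  induction s using Finset.induction_on generalizing b with
  | empty => simp
  | insert j s hj ih =>
    suffices hbj : b j = 0 by
      intro i hi
      rcases Finset.mem_insert.mp hi with rfl | hi
      · exact hbj
      · refine ih b (fun x => ?_) i hi
        simpa [Finset.sum_insert hj, hbj] using h x
    by_contra hbj
    let I : TwoSidedIdeal A := TwoSidedIdeal.mk'
      {c | ∃ b : ι → A, b j = c ∧ ∀ x, ∑ i ∈ insert j s, a i * x * b i = 0}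
      ⟨0, rfl, by simp⟩
      (by
        rintro _ _ ⟨b, rfl, hb⟩ ⟨c, rfl, hc⟩
        exact ⟨b + c, rfl, fun x => by
          simp only [Pi.add_apply, mul_add, Finset.sum_add_distrib, hb, hc, add_zero]⟩)
      (by
        rintro _ ⟨b, rfl, hb⟩
        exact ⟨-b, rfl, fun x => by
          simp only [Pi.neg_apply, mul_neg, Finset.sum_neg_distrib, hb, neg_zero]⟩)
      (by
        rintro y _ ⟨b, rfl, hb⟩
        exact ⟨fun i => y * b i, rfl, fun x => by simpa only [mul_assoc] using hb (x * y)⟩)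
      (by
        rintro _ y ⟨b, rfl, hb⟩
        exact ⟨fun i => b i * y, rfl, fun x => by
          simp only [← mul_assoc, ← Finset.sum_mul, hb, zero_mul]⟩)
    have hone : (1 : A) ∈ I := by
      refine IsSimpleRing.one_mem_of_ne_zero_mem I hbj ?_
      rw [TwoSidedIdeal.mem_mk']
      exact ⟨b, rfl, h⟩
    rw [TwoSidedIdeal.mem_mk'] at hone
    obtain ⟨c, hcj, hc⟩ := hone
    have hcentral : ∀ i ∈ insert j s, c i ∈ Subalgebra.center F A := by
      intro i hi
      rw [Subalgebra.mem_center_iff]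
      intro y
      rcases Finset.mem_insert.mp hi with rfl | hi
      · simp [hcj]
      · refine sub_eq_zero.mp (ih (fun i => y * c i - c i * y) (fun x => ?_) i hi)
        have h₁ := hc (x * y)
        have h₂ := congrArg (· * y) (hc x)
        simp only [Finset.sum_mul, zero_mul] at h₂
        have h₃ : ∑ i ∈ insert j s, a i * x * (y * c i - c i * y) = 0 := by
          simp only [mul_sub, Finset.sum_sub_distrib, ← mul_assoc] at h₁ h₂ ⊢
          rw [h₁, h₂, sub_zero]
        simpa [Finset.sum_insert hj, hcj] using h₃
    have hscalar : ∀ i, ∃ k : F, i ∈ insert j s → algebraMap F A k = c i := by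
      intro i
      by_cases hi : i ∈ insert j s
      · have := hcentral i hi
        rw [Algebra.IsCentral.center_eq_bot, Algebra.mem_bot] at this
        exact this.imp fun k hk _ => hk
      · exact ⟨0, fun h => absurd h hi⟩
    choose k hk using hscalar
    have hsum : ∑ i ∈ insert j s, k i • a i = 0 := by
      rw [← hc 1]
      refine Finset.sum_congr rfl fun i hi => ?_
      rw [← hk i hi, mul_one, Algebra.smul_def, Algebra.commutes]
    have hkj := linearIndependent_iff'.mp ha _ _ hsum j (Finset.mem_insert_self j s)
    have := hk j (Finset.mem_insert_self j s)
    rw [hkj, map_zero, hcj] at this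
    exact zero_ne_one this

/-- A faithful module over a commutative semisimple ring contains a vector with trivial
annihilator. -/
theorem Module.exists_forall_smul_eq_zero_imp_of_isSemisimpleRing (R M : Type*) [CommRing R]
    [IsSemisimpleRing R] [AddCommGroup M] [Module R M] [FaithfulSMul R M] :
    ∃ m : M, ∀ r : R, r • m = 0 → r = 0 := by
  obtain ⟨J, ⟨m, rfl⟩, hmin⟩ := WellFounded.has_min (wellFounded_lt (α := Ideal R))
    (Set.range fun m : M => LinearMap.ker (LinearMap.toSpanSingleton R M m)) ⟨_, 0, rfl⟩
  refine ⟨m, ?_⟩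
  obtain ⟨e, he, hker⟩ := IsSemisimpleRing.ideal_eq_span_idempotent
    (LinearMap.ker (LinearMap.toSpanSingleton R M m))
  have hann : ∀ r : R, r • m = 0 ↔ e ∣ r := fun r => by
    rw [← Ideal.mem_span_singleton, ← hker, LinearMap.mem_ker, LinearMap.toSpanSingleton_apply]
  suffices he0 : e = 0 by
    intro r hr
    simpa [he0] using (hann r).mp hr
  by_contra he0
  obtain ⟨x, hx⟩ : ∃ x : M, e • x ≠ 0 := by
    by_contra! hall
    exact he0 (FaithfulSMul.eq_of_smul_eq_smul (α := M) fun x => by rw [hall x, zero_smul])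
  have hem : e • m = 0 := (hann e).mpr dvd_rfl
  have hee : e * e = e := he
  refine hmin _ ⟨m + e • x, rfl⟩ (SetLike.lt_iff_le_and_exists.mpr ⟨fun r hr => ?_, e, ?_, ?_⟩)
  · simp only [LinearMap.mem_ker, LinearMap.toSpanSingleton_apply] at hr ⊢
    have h₁ : (r * e) • x = 0 := by
      have := congrArg (e • ·) hr
      simp only [smul_add, smul_zero, smul_smul] at this
      rwa [mul_comm e r, mul_smul r e m, hem, smul_zero, zero_add, mul_left_comm, hee] at this
    rwa [smul_add, smul_smul, h₁, add_zero] at hr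
  · simpa using hem
  · simpa [smul_add, smul_smul, hem, hee] using hx

open TensorProduct in
/-- If `S` is generated by `x`, then the kernel of the multiplication map `S ⊗[R] S → S` is
generated by `1 ⊗ x - x ⊗ 1`. -/
theorem KaehlerDifferential.ideal_le_span_singleton_of_adjoin_eq_top {R S : Type*} [CommRing R]
    [CommRing S] [Algebra R S] {x : S} (hx : Algebra.adjoin R {x} = ⊤) :
    KaehlerDifferential.ideal R S ≤ Ideal.span {(1 : S) ⊗ₜ[R] x - x ⊗ₜ[R] (1 : S)} := by
  rw [← KaehlerDifferential.span_range_eq_ideal, Ideal.span_le]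
  rintro _ ⟨s, rfl⟩
  have hs : s ∈ Algebra.adjoin R {x} := hx ▸ Algebra.mem_top
  rw [Algebra.adjoin_singleton_eq_range_aeval] at hs
  obtain ⟨p, rfl⟩ := hs
  rw [SetLike.mem_coe, Ideal.mem_span_singleton]
  have h := Polynomial.sub_dvd_eval_sub ((1 : S) ⊗ₜ[R] x) (x ⊗ₜ[R] (1 : S))
    (p.map (algebraMap R (S ⊗[R] S)))
  simp only [Polynomial.eval_map_algebraMap] at h
  have hr := Polynomial.aeval_algHom_apply
    (Algebra.TensorProduct.includeRight : S →ₐ[R] S ⊗[R] S) x p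
  have hl := Polynomial.aeval_algHom_apply
    (Algebra.TensorProduct.includeLeft : S →ₐ[R] S ⊗[R] S) x p
  simp only [Algebra.TensorProduct.includeRight_apply,
    Algebra.TensorProduct.includeLeft_apply] at hr hl
  rwa [hr, hl] at h

open TensorProduct in
/-- The action of `E ⊗[F] E` on `A` by two-sided multiplication through an algebra homomorphism
`φ : E →ₐ[F] A` from a commutative algebra. -/
noncomputable def AlgHom.mulLeftRightTensor {F E A : Type*} [CommRing F] [CommRing E] [Ring A]
    [Algebra F E] [Algebra F A] (φ : E →ₐ[F] A) : E ⊗[F] E →ₐ[F] Module.End F A :=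
  (AlgHom.mulLeftRight F A).comp
    (Algebra.TensorProduct.map φ (φ.toOpposite fun x y => (Commute.all x y).map φ))

open TensorProduct in
@[simp]
theorem AlgHom.mulLeftRightTensor_tmul {F E A : Type*} [CommRing F] [CommRing E] [Ring A]
    [Algebra F E] [Algebra F A] (φ : E →ₐ[F] A) (x y : E) (a : A) :
    φ.mulLeftRightTensor (x ⊗ₜ y) a = φ x * a * φ y := by
  simp [AlgHom.mulLeftRightTensor]

open TensorProduct in
theorem AlgHom.mulLeftRightTensor_injective {F E A : Type*} [Field F] [CommRing E] [Ring A]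
    [Algebra F E] [Algebra F A] [Algebra.IsCentral F A] [IsSimpleRing A] {φ : E →ₐ[F] A}
    (hφ : Function.Injective φ) : Function.Injective φ.mulLeftRightTensor := by
  rw [injective_iff_map_eq_zero]
  intro t ht
  let 𝓑 := Module.Basis.ofVectorSpace F E
  obtain ⟨c, rfl⟩ := TensorProduct.eq_repr_basis_left 𝓑 t
  have ha : LinearIndependent F fun i => φ (𝓑 i) :=
    𝓑.linearIndependent.map' φ.toLinearMap (LinearMap.ker_eq_bot.mpr hφ)
  refine Finset.sum_eq_zero fun i hi => ?_
  have := ha.eq_zero_of_sum_mul_mul_eq_zero c.support (fun i => φ (c i)) (fun x => ?_) i hi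
  · simp only [(map_eq_zero_iff φ hφ).mp this, tmul_zero]
  · have := LinearMap.congr_fun ht x
    simpa [Finsupp.sum, LinearMap.sum_apply] using this

/-- The evaluation at `x` as an algebra homomorphism from `R[X] / (minpoly R x)`. -/
noncomputable def minpoly.adjoinRootLift (R : Type*) {A : Type*} [CommRing R] [Ring A]
    [Algebra R A] (x : A) : AdjoinRoot (minpoly R x) →ₐ[R] A :=
  Ideal.Quotient.liftₐ (Ideal.span {minpoly R x}) (Polynomial.aeval x) fun p hp => by
    obtain ⟨q, rfl⟩ := Ideal.mem_span_singleton.mp hp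
    rw [map_mul, minpoly.aeval, zero_mul]

theorem minpoly.adjoinRootLift_mk {R A : Type*} [CommRing R] [Ring A] [Algebra R A] (x : A)
    (p : Polynomial R) :
    minpoly.adjoinRootLift R x (AdjoinRoot.mk _ p) = Polynomial.aeval x p :=
  rfl

theorem minpoly.adjoinRootLift_root {R A : Type*} [CommRing R] [Ring A] [Algebra R A] (x : A) :
    minpoly.adjoinRootLift R x (AdjoinRoot.root _) = x := by
  rw [AdjoinRoot.root, minpoly.adjoinRootLift_mk, Polynomial.aeval_X]

theorem minpoly.adjoinRootLift_injective {F A : Type*} [Field F] [Ring A] [Algebra F A] (x : A) :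
    Function.Injective (minpoly.adjoinRootLift F x) := by
  rw [injective_iff_map_eq_zero]
  intro y hy
  obtain ⟨p, rfl⟩ := AdjoinRoot.mk_surjective y
  rw [minpoly.adjoinRootLift_mk] at hy
  exact AdjoinRoot.mk_eq_zero.mpr (minpoly.dvd F x hy)

theorem minpoly.range_adjoinRootLift {R A : Type*} [CommRing R] [Ring A] [Algebra R A] (x : A) :
    (minpoly.adjoinRootLift R x).range = Algebra.adjoin R {x} := by
  rw [Algebra.adjoin_singleton_eq_range_aeval]
  ext y
  simp [AdjoinRoot.mk_surjective.exists, minpoly.adjoinRootLift_mk]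

open TensorProduct in
/-- In a central simple algebra of dimension `n²`, the centralizer of a regular semisimple
element `g` (one whose minimal polynomial is separable of degree `n`) is the subalgebra
generated by `g`. -/
theorem centralizer_eq_adjoin_of_regular_semisimple
    {F A : Type*} [Field F] [Ring A] [Algebra F A]
    [Algebra.IsCentral F A] [IsSimpleRing A] [FiniteDimensional F A]
    (n : ℕ) (hn : 0 < n) (hdim : Module.finrank F A = n ^ 2)
    (g : A) (hsep : (minpoly F g).Separable) (hdeg : (minpoly F g).natDegree = n) :
    Subalgebra.centralizer F ({g} : Set A) = Algebra.adjoin F {g} := by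
  have hP : minpoly F g ≠ 0 := minpoly.ne_zero (Algebra.IsIntegral.isIntegral g)
  let E := AdjoinRoot (minpoly F g)
  let x : E := AdjoinRoot.root (minpoly F g)
  have : Module.Finite F E := (AdjoinRoot.powerBasis hP).finite
  have hE : Module.finrank F E = n := by
    rw [(AdjoinRoot.powerBasis hP).finrank, AdjoinRoot.powerBasis_dim, hdeg]
  let φ : E →ₐ[F] A := minpoly.adjoinRootLift F g
  have hφx : φ x = g := minpoly.adjoinRootLift_root g
  have hφ : Function.Injective φ := minpoly.adjoinRootLift_injective g
  have : Algebra.FormallyUnramified F E := AdjoinRoot.formallyUnramified_of_separable hsep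
  have : Algebra.FormallyUnramified F (E ⊗[F] E) := .comp F E (E ⊗[F] E)
  have : IsReduced (E ⊗[F] E) := Algebra.FormallyUnramified.isReduced_of_field F _
  have : IsArtinianRing (E ⊗[F] E) := isArtinian_of_tower F inferInstance
  have : IsSemisimpleRing (E ⊗[F] E) := IsArtinianRing.isSemisimpleRing_of_isReduced _
  let Φ := φ.mulLeftRightTensor
  have hΦ : Function.Injective Φ := AlgHom.mulLeftRightTensor_injective hφ
  let : Module (E ⊗[F] E) A := Module.compHom A Φ.toRingHom
  have : FaithfulSMul (E ⊗[F] E) A := ⟨fun h => hΦ (LinearMap.ext h)⟩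
  obtain ⟨m, hm⟩ := Module.exists_forall_smul_eq_zero_imp_of_isSemisimpleRing (E ⊗[F] E) A
  let ψ : E ⊗[F] E →ₗ[F] A := (LinearMap.applyₗ m).comp Φ.toLinearMap
  have hψ : Function.Injective ψ := by
    rw [injective_iff_map_eq_zero]
    exact hm
  have hR : Module.finrank F (E ⊗[F] E) = n ^ 2 := by
    rw [Module.finrank_tensorProduct, hE, sq]
  have hψs : Function.Surjective ψ :=
    (LinearMap.injective_iff_surjective_of_finrank_eq_finrank (hR.trans hdim.symm)).mp hψ
  let t : E ⊗[F] E := 1 ⊗ₜ x - x ⊗ₜ 1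
  have hle : Algebra.adjoin F {g} ≤ Subalgebra.centralizer F {g} :=
    Algebra.adjoin_le (by simp [Set.mem_centralizer_iff])
  -- The annihilator of `t` maps onto the centralizer.
  have hC : Subalgebra.toSubmodule (Subalgebra.centralizer F {g}) ≤
      (LinearMap.ker (LinearMap.mulLeft F t)).map ψ := by
    intro c hc
    obtain ⟨r, rfl⟩ := hψs c
    refine ⟨r, ?_, rfl⟩
    have hcomm : g * ψ r = ψ r * g := by simpa [Subalgebra.mem_centralizer_iff] using hc
    have : ψ (t * r) = Φ t (ψ r) := by simp [ψ]
    refine hψ ?_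
    rw [LinearMap.mulLeft_apply, this, map_zero]
    simp [t, Φ, hφx, hcomm]
  have hrange : LinearMap.ker (Algebra.TensorProduct.lmul' F : E ⊗[F] E →ₐ[F] E).toLinearMap ≤
      LinearMap.range (LinearMap.mulLeft F t) := by
    intro r hr
    have := KaehlerDifferential.ideal_le_span_singleton_of_adjoin_eq_top
      (AdjoinRoot.adjoinRoot_eq_top (f := minpoly F g))
      (show r ∈ KaehlerDifferential.ideal F E from hr)
    obtain ⟨s, rfl⟩ := Ideal.mem_span_singleton.mp this
    exact ⟨s, rfl⟩
  have h₁ := LinearMap.finrank_range_add_finrank_ker (LinearMap.mulLeft F t)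
  have h₂ := LinearMap.finrank_range_add_finrank_ker
    (Algebra.TensorProduct.lmul' F : E ⊗[F] E →ₐ[F] E).toLinearMap
  have h₃ := Submodule.finrank_mono hrange
  have h₄ := Submodule.finrank_le
    (LinearMap.range (Algebra.TensorProduct.lmul' F : E ⊗[F] E →ₐ[F] E).toLinearMap)
  have h₅ := (Submodule.finrank_mono hC).trans (Submodule.finrank_map_le ψ _)
  have h₆ : Module.finrank F E ≤ Module.finrank F (Algebra.adjoin F {g}) := by
    rw [← LinearMap.finrank_range_of_inj (f := φ.toLinearMap) hφ]
    exact Submodule.finrank_mono (t := Subalgebra.toSubmodule (Algebra.adjoin F {g}))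
      (minpoly.range_adjoinRootLift g).le
  refine (Subalgebra.toSubmodule_injective (Submodule.eq_of_le_of_finrank_le
    (Subalgebra.toSubmodule.le_iff_le.mpr hle) ?_)).symm
  change _ ≤ Module.finrank F (Algebra.adjoin F {g})
  omega
end

section
/- Let n be a positive integer and let m be a proper divisor of n (that is, m divides n and m ≠ n). Let V be a finite set, and for each v ∈ V let d_v, r_v, x_v be positive integers such that: r_v · d_v = n for all v; gcd(x_v, d_v) = 1 for all v; the least common multiple of the family (d_v)_{v ∈ V} equals n; and n divides the sum Σ_{v ∈ V} r_v · x_v. Then there exist two distinct elements v, w ∈ V such that d_v does not divide m and d_w does not divide m. -/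
/-- The arithmetic lemma from the proof of the simple spectral side: if `m` is a proper divisor
of `n`, and the local indices `d v` (with `r v * d v = n`, `gcd (x v) (d v) = 1`,
`lcm (d v) = n` and `n ∣ ∑ r v * x v`) come from a global division algebra, then there are two
distinct places `v`, `w` at which `d v` and `d w` do not divide `m`. -/
theorem exists_two_places_not_dvd
    (n m : ℕ) (hn : 0 < n) (hm : m ∣ n) (hmn : m ≠ n)
    (V : Type*) [Fintype V]
    (d r x : V → ℕ)
    (hd : ∀ v, 0 < d v) (hr : ∀ v, 0 < r v) (hx : ∀ v, 0 < x v)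
    (hrd : ∀ v, r v * d v = n)
    (hcop : ∀ v, Nat.gcd (x v) (d v) = 1)
    (hlcm : Finset.univ.lcm d = n)
    (hsum : n ∣ ∑ v, r v * x v) :
    ∃ v w : V, v ≠ w ∧ ¬ d v ∣ m ∧ ¬ d w ∣ m := by
  classical
  obtain ⟨v, hv⟩ : ∃ v, ¬ d v ∣ m := by
    by_contra! h
    exact hmn (Nat.dvd_antisymm hm (hlcm ▸ Finset.lcm_dvd fun v _ => h v))
  by_contra! h
  have hother : ∀ w, w ≠ v → d w ∣ m := fun w hw => by
    by_contra hwm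
    exact hwm (h v w hw.symm hv)
  have hrest : n ∣ ∑ w ∈ Finset.univ.erase v, m * (r w * x w) :=
    Finset.dvd_sum fun w hw => by
      obtain ⟨c, hc⟩ := hother w (Finset.ne_of_mem_erase hw)
      exact ⟨c * x w, by rw [hc, ← hrd w]; ring⟩
  have htotal : n ∣ ∑ w, m * (r w * x w) := by
    rw [← Finset.mul_sum]
    exact hsum.mul_left m
  rw [← Finset.sum_erase_add _ _ (Finset.mem_univ v), Nat.dvd_add_right hrest] at htotal
  have hdvd : r v * d v ∣ r v * (m * x v) := by
    rw [hrd v, mul_left_comm]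
    exact htotal
  exact hv ((Nat.Coprime.symm (hcop v)).dvd_of_dvd_mul_right
    (Nat.dvd_of_mul_dvd_mul_left (hr v) hdvd))
end

section
/- Let F be a field and let A be a finite-dimensional central simple algebra over F with dim_F A = n² for a positive integer n. Let g, g' ∈ A be two elements whose minimal polynomials over F are equal, and assume this common minimal polynomial is separable of degree n. Then g and g' are conjugate in A: there exists a unit u ∈ A^× such that g' = u g u^{-1}. -/
open TensorProduct

/-- A central simple algebra remains simple after extension of scalars to a field. -/
theorem isSimpleRing_tensorProduct_field (F A K : Type*) [Field F] [Ring A] [Algebra F A]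
    [Algebra.IsCentral F A] [IsSimpleRing A] [Field K] [Algebra F K] :
    IsSimpleRing (A ⊗[F] K) := by
  classical
  let b := Module.Basis.ofVectorSpace F K
  let e := TensorProduct.equivFinsuppOfBasisRight (M := A) b
  have hl (x : A) (s : A ⊗[F] K) (i) : e ((x ⊗ₜ 1) * s) i = x * e s i := by
    induction s with
    | zero => simp
    | tmul y z => simp [e]
    | add y z hy hz => simp [mul_add, hy, hz]
  have hr (x : A) (s : A ⊗[F] K) (i) : e (s * (x ⊗ₜ 1)) i = e s i * x := by
    induction s with
    | zero => simp
    | tmul y z => simp [e]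
    | add y z hy hz => simp [add_mul, hy, hz]
  rw [isSimpleRing_iff_isTwoSided_imp]
  refine ⟨inferInstance, fun I hI ↦ or_iff_not_imp_left.mpr fun hbot ↦ ?_⟩
  obtain ⟨t₀, ht₀, ht₀'⟩ := Submodule.exists_mem_ne_zero_of_ne_bot hbot
  obtain ⟨t, ⟨htI, ht0⟩, hmin⟩ := exists_minimalFor_of_wellFoundedLT
    (fun t : A ⊗[F] K ↦ t ∈ I ∧ t ≠ 0) (fun t ↦ (e t).support.card) ⟨t₀, ht₀, ht₀'⟩
  obtain ⟨i₀, hi₀⟩ : ∃ i, e t i ≠ 0 := by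
    by_contra! hz
    exact ht0 (e.injective (by ext i; simpa using hz i))
  let J : Ideal A :=
    { carrier := {c | ∃ s ∈ I, (∀ i, e t i = 0 → e s i = 0) ∧ e s i₀ = c}
      zero_mem' := ⟨0, I.zero_mem, by simp, by simp⟩
      add_mem' := by
        rintro _ _ ⟨s, hs, h, rfl⟩ ⟨s', hs', h', rfl⟩
        exact ⟨s + s', I.add_mem hs hs', fun i hi ↦ by simp [h i hi, h' i hi], by simp⟩
      smul_mem' := by
        rintro x _ ⟨s, hs, h, rfl⟩
        exact ⟨(x ⊗ₜ 1) * s, I.mul_mem_left _ hs, fun i hi ↦ by rw [hl, h i hi, mul_zero], hl ..⟩ }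
  have hJ : J.IsTwoSided := ⟨by
    rintro _ x ⟨s, hs, h, rfl⟩
    exact ⟨s * (x ⊗ₜ 1), hI.mul_mem_of_left _ hs, fun i hi ↦ by rw [hr, h i hi, zero_mul],
      hr ..⟩⟩
  have hJtop : J = ⊤ := by
    refine ((isSimpleRing_iff_isTwoSided_imp.mp ‹IsSimpleRing A›).2 J hJ).resolve_left fun h ↦ ?_
    exact hi₀ ((Submodule.eq_bot_iff J).mp h _ ⟨t, htI, fun _ h ↦ h, rfl⟩)
  obtain ⟨s, hsI, hst, hs1⟩ : (1 : A) ∈ J := hJtop ▸ Submodule.mem_top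
  have hcomm (x : A) : (x ⊗ₜ 1) * s = s * (x ⊗ₜ 1) := by
    by_contra hne
    have hle := hmin (j := (x ⊗ₜ 1) * s - s * (x ⊗ₜ 1))
      ⟨I.sub_mem (I.mul_mem_left _ hsI) (hI.mul_mem_of_left _ hsI), sub_ne_zero.mpr hne⟩
    have hsub : (e ((x ⊗ₜ 1) * s - s * (x ⊗ₜ 1))).support ⊆ (e t).support := fun i hi ↦ by
      rw [Finsupp.mem_support_iff] at hi ⊢
      refine fun h0 ↦ hi ?_
      rw [map_sub, Finsupp.sub_apply, hl, hr, hst i h0, mul_zero, zero_mul, sub_zero]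
    refine (Finset.card_lt_card ((Finset.ssubset_iff_of_subset hsub).mpr
      ⟨i₀, Finsupp.mem_support_iff.mpr hi₀, ?_⟩)).not_ge (hle (Finset.card_le_card hsub))
    rw [Finsupp.notMem_support_iff, map_sub, Finsupp.sub_apply, hl, hr, hs1]
    simp
  have hc (i) : ∃ c : F, algebraMap F A c = e s i := by
    have : e s i ∈ Subalgebra.center F A := by
      rw [Subalgebra.mem_center_iff]
      intro x
      rw [← hl, ← hr, hcomm]
    exact Algebra.IsCentral.out this
  choose c hc using hc
  have hs : s = 1 ⊗ₜ ((e s).sum fun i _ ↦ c i • b i) := by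
    conv_lhs => rw [← e.symm_apply_apply s]
    rw [TensorProduct.equivFinsuppOfBasisRight_symm_apply, Finsupp.sum, Finsupp.sum,
      TensorProduct.tmul_sum]
    refine Finset.sum_congr rfl fun i _ ↦ ?_
    rw [← hc, Algebra.algebraMap_eq_smul_one, TensorProduct.smul_tmul]
  set k := (e s).sum fun i _ ↦ c i • b i
  have hk : k ≠ 0 := by
    intro hk
    rw [hk, tmul_zero] at hs
    simp [hs] at hs1
  rw [Ideal.eq_top_iff_one]
  have := I.mul_mem_left ((1 : A) ⊗ₜ k⁻¹) hsI
  rwa [hs, Algebra.TensorProduct.tmul_mul_tmul, inv_mul_cancel₀ hk, one_mul] at this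

theorem isIsotypicOfType_of_isSimpleRing (R M : Type*) [Ring R] [IsSimpleRing R]
    [IsArtinianRing R] [AddCommGroup M] [Module R M] (S : Ideal R) [IsSimpleModule R S] :
    IsIsotypicOfType R M S := by
  intro m hm
  obtain ⟨I, ⟨e⟩⟩ := IsSemisimpleRing.exists_linearEquiv_ideal_of_isSimpleModule R m
  have := IsSimpleModule.congr e.symm
  obtain ⟨e'⟩ := IsSimpleRing.isIsotypic R R S I
  exact ⟨e.trans e'⟩

/-- Finite-dimensional modules of equal dimension over a finite-dimensional simple algebra are
isomorphic. -/
theorem nonempty_linearEquiv_of_finrank_eq {F R M N : Type*} [Field F] [Ring R] [Algebra F R]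
    [IsSimpleRing R] [Module.Finite F R]
    [AddCommGroup M] [Module F M] [Module R M] [IsScalarTower F R M] [Module.Finite F M]
    [AddCommGroup N] [Module F N] [Module R N] [IsScalarTower F R N] [Module.Finite F N]
    (h : Module.finrank F M = Module.finrank F N) : Nonempty (M ≃ₗ[R] N) := by
  have : IsArtinianRing R := .of_finite F R
  have : Module.Finite R M := .of_restrictScalars_finite F R M
  have : Module.Finite R N := .of_restrictScalars_finite F R N
  obtain ⟨S, hS⟩ := IsAtomic.exists_atom (Submodule R R)
  rw [← isSimpleModule_iff_isAtom] at hS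
  have := IsSimpleModule.nontrivial R S
  obtain ⟨m, ⟨eM⟩⟩ := (isIsotypicOfType_of_isSimpleRing R M S).linearEquiv_fun
  obtain ⟨n, ⟨eN⟩⟩ := (isIsotypicOfType_of_isSimpleRing R N S).linearEquiv_fun
  have : Module.Finite F S := inferInstanceAs (Module.Finite F (S.restrictScalars F))
  have hS : 0 < Module.finrank F S := Module.finrank_pos
  rw [(eM.restrictScalars F).finrank_eq, (eN.restrictScalars F).finrank_eq,
    Module.finrank_pi_fintype, Module.finrank_pi_fintype] at h
  have hmn : m = n := by simpa [hS.ne'] using h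
  subst hmn
  exact ⟨eM.trans eN.symm⟩

section TwoActions

variable {F A K M N : Type*} [Field F] [Ring A] [Algebra F A] [Algebra.IsCentral F A]
  [IsSimpleRing A] [FiniteDimensional F A] [Field K] [Algebra F K]
  [AddCommGroup M] [Module F M] [Module A M] [Module K M] [IsScalarTower F A M]
  [IsScalarTower F K M] [SMulCommClass A K M]
  [AddCommGroup N] [Module F N] [Module A N] [Module K N] [IsScalarTower F A N]
  [IsScalarTower F K N] [SMulCommClass A K N]

/-- A module over `A` on which `K` acts by commuting operators has dimension at least
`√(dim A)` over `K`. -/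
theorem finrank_le_sq_finrank [Nontrivial M] [Module.Finite K M] :
    Module.finrank F A ≤ Module.finrank K M ^ 2 := by
  have := isSimpleRing_tensorProduct_field F A K
  have : IsSimpleRing (K ⊗[F] A) :=
    .of_ringEquiv (Algebra.TensorProduct.comm F A K).toRingEquiv inferInstance
  have := SMulCommClass.symm A K M
  let f : K ⊗[F] A →ₐ[K] Module.End K M :=
    Algebra.TensorProduct.lift (Algebra.ofId K _) (Algebra.lsmul F K M)
      fun k _ ↦ Algebra.commutes k _
  have hf := LinearMap.finrank_le_finrank_of_injective (f := f.toLinearMap) f.toRingHom.injective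
  rwa [Module.finrank_baseChange, Module.finrank_linearMap, ← sq] at hf

theorem exists_linearEquiv_of_finrank_eq [Module.Finite F K] [Module.Finite F M]
    [Module.Finite F N] (h : Module.finrank F M = Module.finrank F N) :
    ∃ f : M ≃ₗ[A] N, ∀ (k : K) (x : M), f (k • x) = k • f x := by
  have := isSimpleRing_tensorProduct_field F A K
  let _ : Module (A ⊗[F] K) M := TensorProduct.Algebra.module
  let _ : Module (A ⊗[F] K) N := TensorProduct.Algebra.module
  have : IsScalarTower F (A ⊗[F] K) M := .of_algebraMap_smul fun r x ↦ by
    rw [Algebra.TensorProduct.algebraMap_apply, TensorProduct.Algebra.smul_def, one_smul,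
      algebraMap_smul]
  have : IsScalarTower F (A ⊗[F] K) N := .of_algebraMap_smul fun r x ↦ by
    rw [Algebra.TensorProduct.algebraMap_apply, TensorProduct.Algebra.smul_def, one_smul,
      algebraMap_smul]
  obtain ⟨f⟩ := nonempty_linearEquiv_of_finrank_eq (R := A ⊗[F] K) h
  refine ⟨{ f with map_smul' := fun a x ↦ ?_ }, fun k x ↦ ?_⟩
  · simpa [TensorProduct.Algebra.smul_def] using f.map_smul (a ⊗ₜ 1) x
  · simpa [TensorProduct.Algebra.smul_def] using f.map_smul (1 ⊗ₜ k) x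

end TwoActions

section LeftCorner

variable {F A K : Type*} [Field F] [Ring A] [Algebra F A] [Field K] [Algebra F K]

/-- The left ideal `A * ψ 1`. -/
def leftCorner (ψ : K →ₙₐ[F] A) : Submodule A A where
  carrier := {x | x * ψ 1 = x}
  zero_mem' := zero_mul _
  add_mem' hx hy := by
    change (_ + _) * ψ 1 = _ + _
    rw [add_mul, show _ * ψ 1 = _ from hx, show _ * ψ 1 = _ from hy]
  smul_mem' a x hx := by
    change a * x * ψ 1 = a * x
    rw [mul_assoc, show x * ψ 1 = x from hx]

theorem mem_leftCorner {ψ : K →ₙₐ[F] A} {x : A} : x ∈ leftCorner ψ ↔ x * ψ 1 = x := Iff.rfl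

theorem mul_map_mem_leftCorner (ψ : K →ₙₐ[F] A) (x : A) (k : K) : x * ψ k ∈ leftCorner ψ := by
  rw [mem_leftCorner, mul_assoc, ← map_mul, mul_one]

theorem map_mem_leftCorner (ψ : K →ₙₐ[F] A) (k : K) : ψ k ∈ leftCorner ψ := by
  simpa using mul_map_mem_leftCorner ψ 1 k

/-- `K` acts on `A * ψ 1` by right multiplication through `ψ`. -/
instance (ψ : K →ₙₐ[F] A) : Module K (leftCorner ψ) where
  smul k x := ⟨x * ψ k, mul_map_mem_leftCorner ψ x k⟩
  one_smul x := Subtype.ext x.2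
  mul_smul k l x := Subtype.ext <| show (x : A) * ψ (k * l) = x * ψ l * ψ k by
    rw [mul_comm, map_mul, mul_assoc]
  smul_zero k := Subtype.ext <| zero_mul (ψ k)
  smul_add k x y := Subtype.ext <| add_mul (x : A) y (ψ k)
  add_smul k l x := Subtype.ext <| show (x : A) * ψ (k + l) = x * ψ k + x * ψ l by
    rw [map_add, mul_add]
  zero_smul x := Subtype.ext <| show (x : A) * ψ 0 = 0 by rw [map_zero, mul_zero]

theorem coe_smul_leftCorner (ψ : K →ₙₐ[F] A) (k : K) (x : leftCorner ψ) :
    ((k • x : leftCorner ψ) : A) = x * ψ k := rfl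

instance (ψ : K →ₙₐ[F] A) : SMulCommClass A K (leftCorner ψ) where
  smul_comm a k x := Subtype.ext <| (mul_assoc a (x : A) (ψ k)).symm

instance (ψ : K →ₙₐ[F] A) : IsScalarTower F K (leftCorner ψ) where
  smul_assoc r k x := Subtype.ext <| show (x : A) * ψ (r • k) = r • (x * ψ k) by
    rw [map_smul, mul_smul_comm]

/-- Homomorphisms of a field into a central simple algebra, not necessarily unital, are
intertwined if they generate left ideals of the same dimension. -/
theorem exists_intertwining_of_finrank_leftCorner_eq [Algebra.IsCentral F A] [IsSimpleRing A]
    [FiniteDimensional F A] [FiniteDimensional F K] {ψ ψ' : K →ₙₐ[F] A}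
    (h : Module.finrank F (leftCorner ψ) = Module.finrank F (leftCorner ψ')) :
    ∃ a b : A, a * b = ψ 1 ∧ b * a = ψ' 1 ∧ ψ 1 * a = a ∧ a * ψ' 1 = a ∧ ψ' 1 * b = b ∧
      b * ψ 1 = b ∧ ∀ k, ψ k * a = a * ψ' k := by
  have : Module.Finite F (leftCorner ψ) :=
    inferInstanceAs (Module.Finite F ((leftCorner ψ).restrictScalars F))
  have : Module.Finite F (leftCorner ψ') :=
    inferInstanceAs (Module.Finite F ((leftCorner ψ').restrictScalars F))
  obtain ⟨f, hf⟩ := exists_linearEquiv_of_finrank_eq (A := A) (K := K) h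
  let e : leftCorner ψ := ⟨ψ 1, map_mem_leftCorner ψ 1⟩
  let e' : leftCorner ψ' := ⟨ψ' 1, map_mem_leftCorner ψ' 1⟩
  have he (x : leftCorner ψ) : (x : A) • e = x := Subtype.ext x.2
  have he' (x : leftCorner ψ') : (x : A) • e' = x := Subtype.ext x.2
  have hfe (x : leftCorner ψ) : (x : A) * f e = f x := by
    rw [← smul_eq_mul, ← Submodule.coe_smul, ← map_smul, he]
  have hfe' (x : leftCorner ψ') : (x : A) * f.symm e' = f.symm x := by
    rw [← smul_eq_mul, ← Submodule.coe_smul, ← map_smul, he']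
  refine ⟨f e, f.symm e', ?_, ?_, hfe e, (f e).2, hfe' e', (f.symm e').2, fun k ↦ ?_⟩
  · rw [hfe', f.symm_apply_apply]
  · rw [hfe, f.apply_symm_apply]
  · rw [hfe ⟨ψ k, map_mem_leftCorner ψ k⟩, ← coe_smul_leftCorner, ← hf]
    congr 2
    refine Subtype.ext ?_
    rw [coe_smul_leftCorner, ← map_mul, one_mul]

end LeftCorner

section Pi

variable {F A ι : Type*} [Field F] [Ring A] [Algebra F A] [DecidableEq ι]
  {K : ι → Type*} [∀ i, Field (K i)] [∀ i, Algebra F (K i)]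

/-- The restriction of a homomorphism to one factor of a product algebra. -/
def restrictFactor (Φ : (∀ i, K i) →ₐ[F] A) (i : ι) : K i →ₙₐ[F] A where
  toFun k := Φ (Pi.single i k)
  map_smul' r k := by rw [Pi.single_smul, map_smul]; rfl
  map_zero' := by rw [Pi.single_zero, map_zero]
  map_add' k l := by rw [Pi.single_add, map_add]
  map_mul' k l := by rw [Pi.single_mul, map_mul]

theorem restrictFactor_apply (Φ : (∀ i, K i) →ₐ[F] A) (i : ι) (k : K i) :
    restrictFactor Φ i k = Φ (Pi.single i k) := rfl

theorem restrictFactor_mul_of_ne (Φ : (∀ i, K i) →ₐ[F] A) {i j : ι} (hij : i ≠ j) (k : K i)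
    (l : K j) : restrictFactor Φ i k * restrictFactor Φ j l = 0 := by
  rw [restrictFactor_apply, restrictFactor_apply, ← map_mul]
  convert map_zero Φ
  ext m
  obtain rfl | hm := eq_or_ne m i
  · simp [hij]
  · simp [hm]

variable [Fintype ι]

theorem sum_restrictFactor (Φ : (∀ i, K i) →ₐ[F] A) (x : ∀ i, K i) :
    ∑ i, restrictFactor Φ i (x i) = Φ x := by
  simp_rw [restrictFactor_apply, ← map_sum, Finset.univ_sum_single]

theorem sum_finrank_leftCorner_le [FiniteDimensional F A] (Φ : (∀ i, K i) →ₐ[F] A) :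
    ∑ i, Module.finrank F (leftCorner (restrictFactor Φ i)) ≤ Module.finrank F A := by
  have (i : ι) : Module.Finite F (leftCorner (restrictFactor Φ i)) :=
    inferInstanceAs (Module.Finite F ((leftCorner (restrictFactor Φ i)).restrictScalars F))
  rw [← Module.finrank_pi_fintype]
  let f : (∀ i, leftCorner (restrictFactor Φ i)) →ₗ[F] A :=
    ∑ i, ((leftCorner (restrictFactor Φ i)).subtype.restrictScalars F) ∘ₗ LinearMap.proj i
  have hf (x) : f x = ∑ i, (x i : A) := by simp [f]
  refine LinearMap.finrank_le_finrank_of_injective (f := f)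
    ((injective_iff_map_eq_zero f).mpr fun x hx ↦ ?_)
  ext j
  have hj : f x * restrictFactor Φ j 1 = x j := by
    rw [hf, Finset.sum_mul, Finset.sum_eq_single j, mem_leftCorner.mp (x j).2]
    · intro i _ hij
      rw [← mem_leftCorner.mp (x i).2, mul_assoc, restrictFactor_mul_of_ne Φ hij, mul_zero]
    · simp
  rw [← hj, hx, zero_mul]
  rfl

variable [Algebra.IsCentral F A] [IsSimpleRing A] [FiniteDimensional F A]
  [∀ i, FiniteDimensional F (K i)]

theorem finrank_leftCorner_restrictFactor {Φ : (∀ i, K i) →ₐ[F] A} (hΦ : Function.Injective Φ)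
    (hdim : Module.finrank F A = (∑ i, Module.finrank F (K i)) ^ 2) (i : ι) :
    Module.finrank F (leftCorner (restrictFactor Φ i)) =
      Module.finrank F (K i) * ∑ j, Module.finrank F (K j) := by
  have hle (i : ι) : Module.finrank F (K i) * ∑ j, Module.finrank F (K j) ≤
      Module.finrank F (leftCorner (restrictFactor Φ i)) := by
    have : Module.Finite F (leftCorner (restrictFactor Φ i)) :=
      inferInstanceAs (Module.Finite F ((leftCorner (restrictFactor Φ i)).restrictScalars F))
    have : Module.Finite (K i) (leftCorner (restrictFactor Φ i)) :=
      .of_restrictScalars_finite F _ _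
    have : Nontrivial (leftCorner (restrictFactor Φ i)) :=
      ⟨⟨_, map_mem_leftCorner _ 1⟩, 0, fun h ↦ one_ne_zero (α := K i) <| by
        have h0 : Φ (Pi.single i 1) = 0 := congrArg Subtype.val h
        simpa using hΦ (h0.trans (map_zero Φ).symm)⟩
    rw [← Module.finrank_mul_finrank F (K i) (leftCorner _)]
    refine Nat.mul_le_mul_left _ ((Nat.pow_le_pow_iff_left two_ne_zero).mp ?_)
    exact hdim ▸ finrank_le_sq_finrank
  refine (((Finset.sum_eq_sum_iff_of_le fun i _ ↦ hle i).mp (le_antisymm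
    (Finset.sum_le_sum fun i _ ↦ hle i) ?_)) i (Finset.mem_univ i)).symm
  rw [← Finset.sum_mul, ← sq, ← hdim]
  exact sum_finrank_leftCorner_le Φ

/-- Two embeddings of a product of fields as a subalgebra of dimension `n` in a central simple
algebra of dimension `n²` are conjugate. -/
theorem exists_unit_conj_of_injective_pi {Φ Φ' : (∀ i, K i) →ₐ[F] A}
    (hΦ : Function.Injective Φ) (hΦ' : Function.Injective Φ')
    (hdim : Module.finrank F A = (∑ i, Module.finrank F (K i)) ^ 2) :
    ∃ u : Aˣ, ∀ x, Φ' x = u * Φ x * ↑u⁻¹ := by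
  choose a b hab hba hea hae heb hbe hψ using fun i ↦
    exists_intertwining_of_finrank_leftCorner_eq
      ((finrank_leftCorner_restrictFactor hΦ' hdim i).trans
        (finrank_leftCorner_restrictFactor hΦ hdim i).symm)
  have mul_of_ne {i j : ι} (hij : i ≠ j) (x) : restrictFactor Φ' i x * a j = 0 := by
    rw [← hea, ← mul_assoc, restrictFactor_mul_of_ne Φ' hij, zero_mul]
  have of_ne_mul {i j : ι} (hij : i ≠ j) (x) : a i * restrictFactor Φ j x = 0 := by
    rw [← hae, mul_assoc, restrictFactor_mul_of_ne Φ hij, mul_zero]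
  have hsum : (∑ i, a i) * ∑ i, b i = 1 := by
    rw [Finset.sum_mul_sum, ← map_one Φ', ← sum_restrictFactor]
    refine Finset.sum_congr rfl fun i _ ↦ ?_
    rw [Finset.sum_eq_single i (fun j _ hji ↦ ?_) (by simp), hab, Pi.one_apply]
    rw [← heb, ← mul_assoc, of_ne_mul hji.symm, zero_mul]
  have hsum' : (∑ i, b i) * ∑ i, a i = 1 := by
    rw [Finset.sum_mul_sum, ← map_one Φ, ← sum_restrictFactor]
    refine Finset.sum_congr rfl fun i _ ↦ ?_
    rw [Finset.sum_eq_single i (fun j _ hji ↦ ?_) (by simp), hba, Pi.one_apply]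
    rw [← hbe, mul_assoc, mul_of_ne hji.symm, mul_zero]
  refine ⟨⟨∑ i, a i, ∑ i, b i, hsum, hsum'⟩, fun x ↦ ?_⟩
  rw [Units.eq_mul_inv_iff_mul_eq, ← sum_restrictFactor Φ', ← sum_restrictFactor Φ]
  simp only [Finset.sum_mul_sum]
  refine Finset.sum_congr rfl fun i _ ↦ ?_
  rw [Finset.sum_eq_single i (fun j _ hji ↦ mul_of_ne hji.symm _) (by simp),
    Finset.sum_eq_single i (fun j _ hji ↦ of_ne_mul hji.symm _) (by simp), hψ]

end Pi

/-- Two embeddings of a reduced commutative algebra of dimension `n` in a central simple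
algebra of dimension `n²` are conjugate. -/
theorem exists_unit_conj_of_injective {F A L : Type*} [Field F] [Ring A] [Algebra F A]
    [Algebra.IsCentral F A] [IsSimpleRing A] [FiniteDimensional F A]
    [CommRing L] [IsReduced L] [Algebra F L] [FiniteDimensional F L] {φ φ' : L →ₐ[F] A}
    (hφ : Function.Injective φ) (hφ' : Function.Injective φ')
    (hdim : Module.finrank F A = Module.finrank F L ^ 2) :
    ∃ u : Aˣ, ∀ x, φ' x = u * φ x * ↑u⁻¹ := by
  classical
  have : IsArtinianRing L := .of_finite F L
  have := Fintype.ofFinite (MaximalSpectrum L)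
  let _ (I : MaximalSpectrum L) : Field (L ⧸ I.asIdeal) := Ideal.Quotient.field I.asIdeal
  let e : L ≃ₐ[F] ∀ I : MaximalSpectrum L, L ⧸ I.asIdeal :=
    (IsArtinianRing.equivPi L).restrictScalars F
  obtain ⟨u, hu⟩ := exists_unit_conj_of_injective_pi (Φ := φ.comp e.symm.toAlgHom)
    (Φ' := φ'.comp e.symm.toAlgHom) (hφ.comp e.symm.injective) (hφ'.comp e.symm.injective)
    (by rw [hdim, e.toLinearEquiv.finrank_eq, Module.finrank_pi_fintype])
  exact ⟨u, fun x ↦ by simpa using hu (e x)⟩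


/-- In a central simple algebra of dimension `n²`, two regular semisimple elements (elements
whose common minimal polynomial is separable of degree `n`) with the same minimal polynomial
are conjugate. -/
theorem conj_of_minpoly_eq_separable
    {F A : Type*} [Field F] [Ring A] [Algebra F A]
    [Algebra.IsCentral F A] [IsSimpleRing A] [FiniteDimensional F A]
    (n : ℕ) (hn : 0 < n) (hdim : Module.finrank F A = n ^ 2)
    (g g' : A) (h : minpoly F g = minpoly F g')
    (hsep : (minpoly F g).Separable) (hdeg : (minpoly F g).natDegree = n) :
    ∃ u : Aˣ, g' = u * g * ↑u⁻¹ := by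
  have hint := IsIntegral.of_finite F g
  have hp : minpoly F g ≠ 0 := minpoly.ne_zero hint
  have : IsReduced (AdjoinRoot (minpoly F g)) :=
    (Ideal.isRadical_iff_quotient_reduced _).mp
      (isRadical_iff_span_singleton.mp hsep.squarefree.isRadical)
  have : FiniteDimensional F (AdjoinRoot (minpoly F g)) :=
    (AdjoinRoot.powerBasis hp).finite
  have hlift (x : A) (hx : minpoly F g = minpoly F x) :
      ∃ φ : AdjoinRoot (minpoly F g) →ₐ[F] A,
        Function.Injective φ ∧ φ (AdjoinRoot.root _) = x := by
    have hker (q : Polynomial F) (hq : q ∈ Ideal.span {minpoly F g}) :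
        Polynomial.aeval x q = 0 := by
      rwa [Ideal.mem_span_singleton, hx, minpoly.dvd_iff] at hq
    refine ⟨Ideal.Quotient.liftₐ _ (Polynomial.aeval x) hker,
      (injective_iff_map_eq_zero _).mpr fun y hy ↦ ?_, Polynomial.aeval_X x⟩
    obtain ⟨q, rfl⟩ := AdjoinRoot.mk_surjective y
    exact AdjoinRoot.mk_eq_zero.mpr (hx ▸ minpoly.dvd F x hy)
  obtain ⟨φ, hφ, hroot⟩ := hlift g rfl
  obtain ⟨φ', hφ', hroot'⟩ := hlift g' h
  obtain ⟨u, hu⟩ := exists_unit_conj_of_injective hφ hφ' (by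
    rw [hdim, (AdjoinRoot.powerBasis hp).finrank, AdjoinRoot.powerBasis_dim, hdeg])
  exact ⟨u, by simpa only [hroot, hroot'] using hu (AdjoinRoot.root _)⟩
end
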